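/- arXiv:2312.17630 — 5 statements merged into one kernel-verified Lean document; each statement's English description precedes it below -/
import Mathlib

section
/- For a finite simple graph G, the matrix M(G) is totally unimodular if and only if every connected component of G is a path (possibly consisting of a single vertex). -/
open scoped Classical

/-- The constraint matrix `M(G) = [[I, B], [Bᵀ, I]]` of the total matching IP,
with rows and columns indexed by `V(G) ⊔ E(G)`. -/
noncomputable def totalMatrix {V : Type*} (G : SimpleGraph V) :
    Matrix (V ⊕ G.edgeSet) (V ⊕ G.edgeSet) ℤ := fun a b =>
  match a, b with
  | Sum.inl v, Sum.inl w => if v = w then 1 else 0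
  | Sum.inl v, Sum.inr e => if v ∈ (e : Sym2 V) then 1 else 0
  | Sum.inr e, Sum.inl v => if v ∈ (e : Sym2 V) then 1 else 0
  | Sum.inr e, Sum.inr f => if e = f then 1 else 0

/-- `Δ(G)`: the maximum absolute value of the determinant of a square submatrix of `M(G)`
(the empty submatrix, of determinant `1`, is allowed). -/
noncomputable def maxSubdet {V : Type*} (G : SimpleGraph V) : ℕ :=
  sSup {d : ℕ | ∃ (k : ℕ) (f g : Fin k → (V ⊕ G.edgeSet)),
    Function.Injective f ∧ Function.Injective g ∧
    d = ((totalMatrix G).submatrix f g).det.natAbs}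

/-- Interval matrices have determinant in `{-1,0,1}`. -/
theorem interval_det (k : ℕ) : ∀ (a b g : Fin k → ℕ),
    (Matrix.of (fun i j : Fin k => if a i ≤ g j ∧ g j < b i then (1 : ℤ) else 0)).det
      ∈ Set.range (SignType.cast : SignType → ℤ) := by
  induction k with
  | zero => intro a b g; exact ⟨1, by simp⟩
  | succ k ih =>
    intro a b g
    obtain ⟨j0, hj0⟩ := Finite.exists_min g
    by_cases hex : ∃ i, a i ≤ g j0 ∧ g j0 < b i
    · obtain ⟨i0, hi0, hmin⟩ : ∃ i0, (a i0 ≤ g j0 ∧ g j0 < b i0) ∧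
          ∀ i, a i ≤ g j0 ∧ g j0 < b i → b i0 ≤ b i := by
        have hne : (Finset.univ.filter (fun i => a i ≤ g j0 ∧ g j0 < b i)).Nonempty := by
          obtain ⟨i, hi⟩ := hex
          exact ⟨i, by simpa using hi⟩
        obtain ⟨i0, h1, h2⟩ := Finset.exists_min_image _ b hne
        refine ⟨i0, by simpa using h1, fun i hi => h2 i (by simpa using hi)⟩
      let c : Fin (k+1) → ℤ := fun i => if i ≠ i0 ∧ a i ≤ g j0 ∧ g j0 < b i then 1 else 0
      let a' : Fin (k+1) → ℕ := fun i =>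
        if i ≠ i0 ∧ a i ≤ g j0 ∧ g j0 < b i then b i0 else a i
      have hdet : (Matrix.of (fun i j : Fin (k+1) =>
            if a i ≤ g j ∧ g j < b i then (1 : ℤ) else 0)).det =
          (Matrix.of (fun i j : Fin (k+1) =>
            if a' i ≤ g j ∧ g j < b i then (1 : ℤ) else 0)).det := by
        apply Matrix.det_eq_of_forall_row_eq_smul_add_const c i0
        · simp [c]
        · intro i j
          have h1 := hj0 j
          have h2 := hmin i
          simp only [Matrix.of_apply, c, a']
          by_cases hi : i ≠ i0 ∧ a i ≤ g j0 ∧ g j0 < b i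
          · have h3 := h2 hi.2
            simp only [hi, ne_eq, not_true_eq_false, false_and, if_false]
            split_ifs <;> first | rfl | omega
          · simp [hi]
      rw [hdet, Matrix.det_succ_column _ j0, Fintype.sum_eq_single i0]
      · have hone : (Matrix.of (fun i j : Fin (k+1) =>
            if a' i ≤ g j ∧ g j < b i then (1 : ℤ) else 0)) i0 j0 = 1 := by
          simp [a', hi0]
        rw [hone, mul_one]
        obtain ⟨s, hs⟩ := ih (a' ∘ i0.succAbove) (b ∘ i0.succAbove) (g ∘ j0.succAbove)
        have he : (Matrix.of (fun i j : Fin (k+1) =>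
            if a' i ≤ g j ∧ g j < b i then (1 : ℤ) else 0)).submatrix
              i0.succAbove j0.succAbove = Matrix.of (fun i j : Fin k =>
            if (a' ∘ i0.succAbove) i ≤ (g ∘ j0.succAbove) j ∧
              (g ∘ j0.succAbove) j < (b ∘ i0.succAbove) i then (1 : ℤ) else 0) := by
          ext i j; simp
        rw [he, ← hs]
        rcases neg_one_pow_eq_or ℤ ((i0 : ℕ) + (j0 : ℕ)) with h | h
        · exact ⟨s, by rw [h]; simp⟩
        · exact ⟨-s, by rw [h]; simp⟩
      · intro i hi
        have hz : (Matrix.of (fun i j : Fin (k+1) =>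
            if a' i ≤ g j ∧ g j < b i then (1 : ℤ) else 0)) i j0 = 0 := by
          simp only [Matrix.of_apply, a']
          split_ifs <;> first | rfl | omega
        rw [hz]; ring
    · refine ⟨0, ?_⟩
      symm
      rw [Matrix.det_eq_zero_of_column_eq_zero j0]
      · simp
      · intro i
        have : ¬ (a i ≤ g j0 ∧ g j0 < b i) := fun h => hex ⟨i, h⟩
        simp [this]

/-- A matrix whose entries say that the positions are at distance at most one. -/
theorem tridiag_tu {m : Type*} (A : Matrix m m ℤ) (π : m → ℕ)
    (h : ∀ a b, A a b = if π a ≤ π b + 1 ∧ π b ≤ π a + 1 then 1 else 0) :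
    A.IsTotallyUnimodular := by
  intro k f g _ _
  have := interval_det k (fun i => π (f i) - 1) (fun i => π (f i) + 2) (fun j => π (g j))
  convert this using 2
  ext i j
  simp only [Matrix.submatrix_apply, h, Matrix.of_apply]
  congr 1
  apply propext
  omega

theorem tu_of_pos {V : Type*} (G : SimpleGraph V) (ψ : V → ℕ) (hinj : Function.Injective ψ)
    (hadj : ∀ v w, G.Adj v w ↔ (ψ v + 1 = ψ w ∨ ψ w + 1 = ψ v)) :
    (totalMatrix G).IsTotallyUnimodular := by
  let π : V ⊕ G.edgeSet → ℕ := fun x => match x with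
    | Sum.inl v => 2 * ψ v
    | Sum.inr e => Sym2.lift ⟨fun u v => ψ u + ψ v, fun u v => add_comm _ _⟩ (e : Sym2 V)
  apply tridiag_tu _ π
  have key : ∀ (v : V) (e : G.edgeSet), v ∈ (e : Sym2 V) ↔
      (2 * ψ v ≤ π (Sum.inr e) + 1 ∧ π (Sum.inr e) ≤ 2 * ψ v + 1) := by
    rintro v ⟨e, he⟩
    induction e using Sym2.ind with
    | _ x y =>
      have hxy : G.Adj x y := he
      rw [hadj] at hxy
      have h1 := hinj.eq_iff (a := v) (b := x)
      have h2 := hinj.eq_iff (a := v) (b := y)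
      simp only [π, Sym2.mem_iff, Sym2.lift_mk, ← h1, ← h2]
      omega
  rintro (v | e) (w | f)
  · have h1 := hinj.eq_iff (a := v) (b := w)
    simp only [totalMatrix, π, ← h1]
    congr 1
    apply propext
    omega
  · have := key v f
    simp only [totalMatrix]
    congr 1
    exact propext this
  · have := key w e
    simp only [totalMatrix]
    congr 1
    rw [this]
    exact propext And.comm
  · simp only [totalMatrix]
    congr 1
    apply propext
    constructor
    · rintro rfl; omega
    · rcases e with ⟨e, he⟩
      rcases f with ⟨f, hf⟩
      induction e using Sym2.ind with
      | _ x y =>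
      induction f using Sym2.ind with
      | _ z t =>
      have hxy : G.Adj x y := he
      have hzt : G.Adj z t := hf
      rw [hadj] at hxy hzt
      simp only [π, Sym2.lift_mk, Subtype.mk.injEq, Sym2.eq_iff, ← hinj.eq_iff]
      omega

theorem exists_pos {V : Type*} [Fintype V] (G : SimpleGraph V)
    (h : ∀ c : G.ConnectedComponent,
        ∃ n : ℕ, Nonempty ((G.induce c.supp) ≃g SimpleGraph.pathGraph n)) :
    ∃ ψ : V → ℕ, Function.Injective ψ ∧
      ∀ v w, G.Adj v w ↔ (ψ v + 1 = ψ w ∨ ψ w + 1 = ψ v) := by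
  choose n hn using h
  let iso := fun c => (hn c).some
  let φ : V → ℕ := fun v => (iso (G.connectedComponentMk v) ⟨v, rfl⟩ : Fin _).val
  have hφ : ∀ c v (hv : G.connectedComponentMk v = c), φ v = (iso c ⟨v, hv⟩ : Fin _).val := by
    intro c v hv; subst hv; rfl
  have hφinj : ∀ v w, G.connectedComponentMk v = G.connectedComponentMk w → φ v = φ w → v = w := by
    intro v w hvw he
    rw [hφ _ v hvw, hφ _ w rfl] at he
    have := (iso (G.connectedComponentMk w)).injective (Fin.ext he)
    exact congrArg Subtype.val this
  have hφadj : ∀ v w, G.connectedComponentMk v = G.connectedComponentMk w →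
      (G.Adj v w ↔ (φ v + 1 = φ w ∨ φ w + 1 = φ v)) := by
    intro v w hvw
    rw [hφ _ v hvw, hφ _ w rfl]
    have := (iso (G.connectedComponentMk w)).map_adj_iff (v := ⟨v, hvw⟩) (w := ⟨w, rfl⟩)
    rw [SimpleGraph.pathGraph_adj] at this
    rw [this]
    simp
  obtain ⟨B, hB⟩ : ∃ B, ∀ v, φ v ≤ B := by
    obtain ⟨B, hB⟩ := (Set.finite_range φ).bddAbove
    exact ⟨B, fun v => hB ⟨v, rfl⟩⟩
  obtain ⟨N, ⟨idx⟩⟩ := Finite.exists_equiv_fin G.ConnectedComponent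
  let ix : V → ℕ := fun v => (idx (G.connectedComponentMk v)).val
  have hix : ∀ v w, ix v = ix w → G.connectedComponentMk v = G.connectedComponentMk w :=
    fun v w he => idx.injective (Fin.ext he)
  have hfar : ∀ v w, ix v < ix w → (B + 2) * ix v + φ v + 1 < (B + 2) * ix w + φ w := by
    intro v w hlt
    have h1 : (B + 2) * (ix v + 1) ≤ (B + 2) * ix w := Nat.mul_le_mul_left _ hlt
    have h2 := hB v
    rw [mul_add] at h1
    omega
  refine ⟨fun v => (B + 2) * ix v + φ v, ?_, ?_⟩
  · intro v w he
    simp only at he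
    rcases lt_trichotomy (ix v) (ix w) with hl | hl | hl
    · have := hfar v w hl; omega
    · rw [hl] at he
      exact hφinj v w (hix v w hl) (by omega)
    · have := hfar w v hl; omega
  · intro v w
    simp only
    by_cases hc : G.connectedComponentMk v = G.connectedComponentMk w
    · rw [hφadj v w hc]
      have : ix v = ix w := by simp [ix, hc]
      rw [this]
      omega
    · have hne : ix v ≠ ix w := fun h => hc (hix v w h)
      constructor
      · intro hadj
        exact absurd (SimpleGraph.ConnectedComponent.connectedComponentMk_eq_of_adj hadj) hc
      · intro h
        rcases lt_or_gt_of_ne hne with hl | hl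
        · have := hfar v w hl; omega
        · have := hfar w v hl; omega

/-- Odd cyclic submatrices obstruct total unimodularity. -/
theorem odd_cyclic {m n : Type*} (A : Matrix m n ℤ) (hA : A.IsTotallyUnimodular) (k : ℕ)
    (hk : Odd k) (hk3 : 3 ≤ k) (f : ℕ → m) (g : ℕ → n)
    (h : ∀ i j, i < k → j < k →
      A (f i) (g j) = if j = i ∨ j = (if i + 1 = k then 0 else i + 1) then 1 else 0) : False := by
  rw [Matrix.isTotallyUnimodular_iff] at hA
  let D : Matrix (Fin k) (Fin k) ℤ := A.submatrix (fun i => f i) (fun j => g j)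
  have hD : D.det ∈ Set.range (SignType.cast : SignType → ℤ) := hA k _ _
  have hk0 : 0 < k := by omega
  let nx : Fin k → Fin k := fun i => ⟨if i.val + 1 = k then 0 else i.val + 1, by
    have := i.2
    split_ifs <;> omega⟩
  have hrow : ∀ (x : Fin k → ℤ) (i : Fin k), (D.mulVec x) i = x i + x (nx i) := by
    intro x i
    have hne : i ≠ nx i := by
      intro he
      have := congrArg Fin.val he
      simp only [nx] at this
      split_ifs at this <;> omega
    have : ∀ j, D i j * x j = (if j = i then x j else 0) + (if j = nx i then x j else 0) := by
      intro j
      simp only [D, Matrix.submatrix_apply, h i j i.2 j.2]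
      have e1 : ((j : ℕ) = i) ↔ j = i := Fin.ext_iff.symm
      have e2 : ((j : ℕ) = (if (i : ℕ) + 1 = k then 0 else (i : ℕ) + 1)) ↔ j = nx i := by
        rw [Fin.ext_iff]
      simp only [e1, e2]
      by_cases h1 : j = i
      · subst h1; simp [hne]
      · simp [h1]
    simp only [Matrix.mulVec, dotProduct, this, Finset.sum_add_distrib]
    simp
  have hne0 : D.det ≠ 0 := by
    intro h0
    obtain ⟨x, hx, hx0⟩ := Matrix.exists_mulVec_eq_zero_iff.mpr h0
    have hs : ∀ i, x i + x (nx i) = 0 := fun i => by rw [← hrow, hx0]; rfl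
    have hp : ∀ t (ht : t < k), x ⟨t, ht⟩ = (-1) ^ t * x ⟨0, hk0⟩ := by
      intro t
      induction t with
      | zero => intro ht; simp
      | succ t ih =>
        intro ht
        have h1 := hs ⟨t, by omega⟩
        have h2 : nx ⟨t, by omega⟩ = ⟨t + 1, ht⟩ := by
          apply Fin.ext
          simp only [nx]
          rw [if_neg (by omega)]
        rw [h2, ih (by omega)] at h1
        rw [pow_succ]
        linarith
    have hl := hs ⟨k - 1, by omega⟩
    have h2 : nx ⟨k - 1, by omega⟩ = ⟨0, hk0⟩ := by
      apply Fin.ext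
      simp only [nx]
      rw [if_pos (by omega)]
    rw [h2, hp (k - 1) (by omega)] at hl
    have hev : Even (k - 1) := by
      obtain ⟨r, hr⟩ := hk
      exact ⟨r, by omega⟩
    rw [hev.neg_one_pow] at hl
    have hx00 : x ⟨0, hk0⟩ = 0 := by omega
    apply hx
    funext i
    have := hp i i.2
    rw [hx00, mul_zero] at this
    exact this
  have heven : (2 : ℤ) ∣ D.det := by
    have h1 : D.adjugate.mulVec (D.mulVec (fun _ => 1)) = D.det • (fun _ => (1 : ℤ)) := by
      rw [Matrix.mulVec_mulVec, Matrix.adjugate_mul, Matrix.smul_mulVec, Matrix.one_mulVec]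
    have h2 := congrFun h1 ⟨0, hk0⟩
    have h3 : D.mulVec (fun _ => 1) = fun _ => (2 : ℤ) := by
      funext i; rw [hrow]; norm_num
    rw [h3] at h2
    simp only [Matrix.mulVec, dotProduct, Pi.smul_apply, smul_eq_mul, mul_one] at h2
    rw [← h2, ← Finset.sum_mul]
    exact Dvd.intro_left _ rfl
  obtain ⟨s, hs⟩ := hD
  rcases s with _ | _ | _ <;> simp at hs <;> omega

theorem no_claw {V : Type*} (G : SimpleGraph V) (hA : (totalMatrix G).IsTotallyUnimodular)
    {v a b c : V} (ha : G.Adj v a) (hb : G.Adj v b) (hc : G.Adj v c)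
    (hab : a ≠ b) (hac : a ≠ c) (hbc : b ≠ c) : False := by
  rw [Matrix.isTotallyUnimodular_iff] at hA
  let e1 : G.edgeSet := ⟨s(v, a), ha⟩
  let e2 : G.edgeSet := ⟨s(v, b), hb⟩
  let e3 : G.edgeSet := ⟨s(v, c), hc⟩
  have h := hA 4 ![Sum.inl v, Sum.inr e1, Sum.inr e2, Sum.inr e3]
    ![Sum.inl v, Sum.inr e1, Sum.inr e2, Sum.inr e3]
  have hM : (totalMatrix G).submatrix ![Sum.inl v, Sum.inr e1, Sum.inr e2, Sum.inr e3]
    ![Sum.inl v, Sum.inr e1, Sum.inr e2, Sum.inr e3] =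
      !![1,1,1,1;1,1,0,0;1,0,1,0;1,0,0,1] := by
    have m1 : e1 ≠ e2 := fun h => hab (Sym2.congr_right.mp (congrArg Subtype.val h))
    have m2 : e1 ≠ e3 := fun h => hac (Sym2.congr_right.mp (congrArg Subtype.val h))
    have m3 : e2 ≠ e3 := fun h => hbc (Sym2.congr_right.mp (congrArg Subtype.val h))
    have k1 : v ∈ (e1 : Sym2 V) := Sym2.mem_mk_left _ _
    have k2 : v ∈ (e2 : Sym2 V) := Sym2.mem_mk_left _ _
    have k3 : v ∈ (e3 : Sym2 V) := Sym2.mem_mk_left _ _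
    ext i j
    fin_cases i <;> fin_cases j <;>
      simp [totalMatrix, k1, k2, k3, m1, m2, m3, m1.symm, m2.symm, m3.symm]
  rw [hM] at h
  have hd : (!![1,1,1,1;1,1,0,0;1,0,1,0;1,0,0,1] : Matrix (Fin 4) (Fin 4) ℤ).det = -2 := by
    simp [Matrix.det_succ_row_zero, Fin.sum_univ_succ, Fin.succAbove]
  rw [hd] at h
  obtain ⟨s, hs⟩ := h
  rcases s with _ | _ | _ <;> simp at hs

theorem no_cycle {V : Type*} (G : SimpleGraph V) (hA : (totalMatrix G).IsTotallyUnimodular)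
    (n : ℕ) (hn : 3 ≤ n) (p : ℕ → V) (hinj : ∀ i j, i < n → j < n → p i = p j → i = j)
    (hadj : ∀ i, i + 1 < n → G.Adj (p i) (p (i + 1))) (hcl : G.Adj (p (n - 1)) (p 0)) :
    False := by
  have hi : ∀ i j, i < n → j < n → (p i = p j ↔ i = j) :=
    fun i j h1 h2 => ⟨hinj i j h1 h2, fun h => h ▸ rfl⟩
  let e0 : G.edgeSet := ⟨s(p (n - 1), p 0), hcl⟩
  let ed : ℕ → G.edgeSet := fun i =>
    if h : i + 1 < n then ⟨s(p i, p (i + 1)), hadj i h⟩ else e0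
  have hed : ∀ i, i + 1 < n → (ed i : Sym2 V) = s(p i, p (i + 1)) := by
    intro i h; simp [ed, h]
  have hed0 : ∀ i, ¬ i + 1 < n → (ed i : Sym2 V) = s(p (n - 1), p 0) := by
    intro i h; simp [ed, h, e0]
  rcases Nat.even_or_odd n with hev | hodd
  · refine odd_cyclic _ hA (n + 1) hev.add_one (by omega)
      (fun i => if i + 1 < n then Sum.inr (ed i) else
        if i + 1 = n then Sum.inl (p (n - 1)) else Sum.inl (p 0))
      (fun j => if j < n then Sum.inl (p j) else Sum.inr e0) ?_
    intro i j hik hjk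
    by_cases h1 : i + 1 < n
    · by_cases h2 : j < n
      · simp only [h1, h2, if_true, totalMatrix, hed i h1, Sym2.mem_iff,
          hi j i h2 (by omega), hi j (i+1) h2 h1]
        rw [if_neg (show ¬ i + 1 = n + 1 by omega)]
      · simp only [h1, h2, if_true, if_false, totalMatrix, Subtype.ext_iff, hed i h1, e0,
          Sym2.eq_iff, hi i (n-1) (by omega) (by omega), hi (i+1) 0 h1 (by omega),
          hi i 0 (by omega) (by omega), hi (i+1) (n-1) h1 (by omega)]
        split_ifs <;> first | rfl | omega
    · by_cases h3 : i + 1 = n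
      · by_cases h2 : j < n
        · simp only [h3, h2, if_true, if_false, totalMatrix, lt_irrefl,
            hi (n-1) j (by omega) h2]
          split_ifs <;> first | rfl | omega
        · simp only [h3, h2, if_true, if_false, totalMatrix, lt_irrefl, e0, Sym2.mem_iff, true_or]
          split_ifs <;> first | rfl | omega
      · by_cases h2 : j < n
        · simp only [h1, h3, h2, if_true, if_false, totalMatrix, hi 0 j (by omega) h2]
          split_ifs <;> first | rfl | omega
        · simp only [h1, h3, h2, if_true, if_false, totalMatrix, e0, Sym2.mem_iff, or_true]
          split_ifs <;> first | rfl | omega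
  · refine odd_cyclic _ hA n hodd hn (fun i => Sum.inr (ed i)) (fun j => Sum.inl (p j)) ?_
    intro i j hik hjk
    by_cases h1 : i + 1 < n
    · simp only [totalMatrix, hed i h1, Sym2.mem_iff, hi j i hjk hik, hi j (i+1) hjk h1]
      rw [if_neg (show ¬ i + 1 = n by omega)]
    · simp only [totalMatrix, hed0 i h1, Sym2.mem_iff, hi j (n-1) hjk (by omega),
        hi j 0 hjk (by omega)]
      split_ifs <;> first | rfl | omega

/-- `p` restricted to `[0,n)` is a path. -/
def IsPth {V : Type*} (G : SimpleGraph V) (p : ℕ → V) (n : ℕ) : Prop :=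
  (∀ i j, i < n → j < n → p i = p j → i = j) ∧ (∀ i, i + 1 < n → G.Adj (p i) (p (i + 1)))

theorem IsPth.prepend {V : Type*} {G : SimpleGraph V} {p : ℕ → V} {n : ℕ} (h : IsPth G p n)
    {x : V} (hx : G.Adj x (p 0)) (hn : ∀ j, j < n → x ≠ p j) :
    IsPth G (fun i => if i = 0 then x else p (i - 1)) (n + 1) := by
  refine ⟨?_, ?_⟩
  · intro i j hi hj he
    rcases i with _ | i <;> rcases j with _ | j
    · rfl
    · simp at he; exact absurd he (hn j (by omega))
    · simp at he; exact absurd he.symm (hn i (by omega))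
    · simp at he; have := h.1 i j (by omega) (by omega) he; omega
  · intro i hi
    rcases i with _ | i
    · simpa using hx
    · simpa using h.2 i (by omega)

theorem IsPth.append {V : Type*} {G : SimpleGraph V} {p : ℕ → V} {n : ℕ} (h : IsPth G p n)
    {x : V} (hx : G.Adj x (p (n - 1))) (hn : ∀ j, j < n → x ≠ p j) :
    IsPth G (fun i => if i < n then p i else x) (n + 1) := by
  refine ⟨?_, ?_⟩
  · intro i j hi hj he
    by_cases h1 : i < n <;> by_cases h2 : j < n <;> simp only [h1, h2, if_true, if_false] at he
    · exact h.1 i j h1 h2 he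
    · exact absurd he.symm (hn i h1)
    · exact absurd he (hn j h2)
    · omega
  · intro i hi
    by_cases h1 : i + 1 < n
    · have h2 : i < n := by omega
      simpa [h1, h2] using h.2 i h1
    · have h2 : i < n := by omega
      have h3 : i = n - 1 := by omega
      simp only [h1, h2, if_true, if_false]
      rw [h3]; exact hx.symm

theorem IsPth.le_card {V : Type*} [Fintype V] {G : SimpleGraph V} {p : ℕ → V} {n : ℕ}
    (h : IsPth G p n) : n ≤ Fintype.card V := by
  have := Fintype.card_le_of_injective (fun i : Fin n => p i)
    (fun i j he => Fin.ext (h.1 i j i.2 j.2 he))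
  simpa using this

theorem IsPth.comp {V : Type*} {G : SimpleGraph V} {p : ℕ → V} {n : ℕ} (h : IsPth G p n)
    (i : ℕ) (hi : i < n) : G.connectedComponentMk (p i) = G.connectedComponentMk (p 0) := by
  induction i with
  | zero => rfl
  | succ i ih =>
    rw [← ih (by omega)]
    exact (SimpleGraph.ConnectedComponent.connectedComponentMk_eq_of_adj (h.2 i hi)).symm

theorem path_of_tu {V : Type*} [Fintype V] (G : SimpleGraph V)
    (hA : (totalMatrix G).IsTotallyUnimodular) (c : G.ConnectedComponent) :
    ∃ n : ℕ, Nonempty ((G.induce c.supp) ≃g SimpleGraph.pathGraph n) := by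
  let S : Set ℕ := {n | 1 ≤ n ∧ ∃ p : ℕ → V, IsPth G p n ∧ G.connectedComponentMk (p 0) = c}
  have hSne : S.Nonempty := by
    obtain ⟨v, hv⟩ := c.exists_rep
    refine ⟨1, le_rfl, fun _ => v, ⟨?_, ?_⟩, hv⟩
    · intro i j hi hj _; omega
    · intro i hi; omega
  have hSb : BddAbove S := ⟨Fintype.card V, by rintro n ⟨_, p, hp, _⟩; exact hp.le_card⟩
  obtain ⟨h1, p, hp, hpc⟩ := Nat.sSup_mem hSne hSb
  have hmax : sSup S + 1 ∉ S := fun h => by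
    have := le_csSup hSb h
    omega
  generalize sSup S = n at h1 hp hmax
  have hclosed : ∀ i x, i < n → G.Adj x (p i) → ∃ j, j < n ∧ x = p j := by
    intro i x hi hx
    by_contra hno
    push Not at hno
    by_cases hi0 : i = 0
    · subst hi0
      refine hmax ⟨by omega, _, hp.prepend hx hno, ?_⟩
      simp only [if_true]
      rw [← hpc]
      exact SimpleGraph.ConnectedComponent.connectedComponentMk_eq_of_adj hx
    by_cases hin : i = n - 1
    · subst hin
      refine hmax ⟨by omega, _, hp.append hx hno, ?_⟩
      rw [if_pos (by omega)]
      exact hpc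
    · have a1 := hp.2 (i - 1) (by omega)
      rw [show i - 1 + 1 = i by omega] at a1
      have a2 := hp.2 i (by omega)
      refine no_claw G hA a1.symm a2 hx.symm ?_ (hno _ (by omega)).symm (hno _ (by omega)).symm
      intro he
      have := hp.1 _ _ (by omega) (by omega) he
      omega
  have hchord : ∀ i j, i < j → j < n → G.Adj (p i) (p j) → i + 1 = j := by
    intro i j hij hj hadj
    by_contra hne
    refine no_cycle G hA (j - i + 1) (by omega) (fun t => p (i + t)) ?_ ?_ ?_
    · intro s t hs ht he
      have := hp.1 _ _ (by omega) (by omega) he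
      omega
    · intro t ht
      exact hp.2 (i + t) (by omega)
    · simp only [add_zero]
      rw [show i + (j - i + 1 - 1) = j by omega]
      exact hadj.symm
  have hwalk : ∀ (u v : V) (w : G.Walk u v), (∃ j, j < n ∧ u = p j) → ∃ j, j < n ∧ v = p j := by
    intro u v w
    induction w with
    | nil => exact id
    | cons hadj w ih =>
      rintro ⟨j, hj, rfl⟩
      exact ih (hclosed j _ hj hadj.symm)
  refine ⟨n, ⟨SimpleGraph.Iso.symm ?_⟩⟩
  let F : Fin n → c.supp := fun i => ⟨p i, by
    rw [SimpleGraph.ConnectedComponent.mem_supp_iff, hp.comp i i.2, hpc]⟩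
  have hF : Function.Bijective F := by
    constructor
    · intro i j he
      exact Fin.ext (hp.1 i j i.2 j.2 (congrArg Subtype.val he))
    · rintro ⟨v, hv⟩
      rw [SimpleGraph.ConnectedComponent.mem_supp_iff, ← hpc, eq_comm,
        SimpleGraph.ConnectedComponent.eq] at hv
      obtain ⟨w⟩ := hv
      obtain ⟨j, hj, rfl⟩ := hwalk _ _ w ⟨0, by omega, rfl⟩
      exact ⟨⟨j, hj⟩, rfl⟩
  refine ⟨Equiv.ofBijective F hF, ?_⟩
  intro i j
  rw [SimpleGraph.pathGraph_adj]
  simp only [Equiv.ofBijective_apply, SimpleGraph.comap_adj, F, Function.Embedding.subtype_apply]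
  constructor
  · intro hadj
    rcases lt_trichotomy i j with h | h | h
    · exact Or.inl (hchord i j h j.2 hadj)
    · subst h; exact absurd hadj (G.loopless.irrefl _)
    · exact Or.inr (hchord j i h i.2 hadj.symm)
  · rintro (h | h)
    · rw [← h]; exact hp.2 i (by omega)
    · rw [← h]; exact (hp.2 j (by omega)).symm

/-- `M(G)` is totally unimodular if and only if every connected component of `G` is a path
(possibly a single vertex), i.e. the induced subgraph on every connected component is
isomorphic to a path graph. -/
theorem stmt3 {V : Type*} [Fintype V] (G : SimpleGraph V) :
    (totalMatrix G).IsTotallyUnimodular ↔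
      ∀ c : G.ConnectedComponent,
        ∃ n : ℕ, Nonempty ((G.induce c.supp) ≃g SimpleGraph.pathGraph n) := by
  constructor
  · intro hA c
    exact path_of_tu G hA c
  · intro h
    obtain ⟨ψ, h1, h2⟩ := exists_pos G h
    exact tu_of_pos G ψ h1 h2
end

section
/- Let G be a finite simple graph and let x_0, x_1, x_2, x_3, x_4 be elements of G (vertices or edges) such that for each i ∈ {1,2,3}, the element x_i is incident to x_{i−1}, x_i, x_{i+1} and to no other element of G (possibly x_0 = x_4, but the elements are otherwise pairwise distinct). Let M' be a minimal witness for G, with row set R and column set C. If x_2 ∈ R ∩ C and x_1, x_2, x_3 all belong to R, then x_0, x_1, x_2, x_3, x_4 all belong to C; symmetrically, if x_2 ∈ R ∩ C and x_1, x_2, x_3 all belong to C, then x_0, x_1, x_2, x_3, x_4 all belong to R. -/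
open scoped Classical

/-- Two elements of `V(G) ⊔ E(G)` are incident iff the corresponding entry of `M(G)` is `1`,
i.e. they are equal, or one is an edge and the other an endpoint of that edge. -/
def Incid {V : Type*} (G : SimpleGraph V) (a b : V ⊕ G.edgeSet) : Prop :=
  totalMatrix G a b = 1

/-- The absolute determinant of the square submatrix of `M(G)` with row set `R` and
column set `C`, where `R.card = C.card`. (Well-defined: the choice of bijections with
`Fin R.card` only affects the sign of the determinant.) -/
noncomputable def subdet {V : Type*} (G : SimpleGraph V)
    (R C : Finset (V ⊕ G.edgeSet)) (h : R.card = C.card) : ℕ :=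
  ((totalMatrix G).submatrix
    (fun i : Fin R.card => (R.equivFin.symm i : V ⊕ G.edgeSet))
    (fun i : Fin R.card => (C.equivFin.symm (Fin.cast h i) : V ⊕ G.edgeSet))).det.natAbs

/-- A minimal witness for `G`: a square submatrix of `M(G)`, given by a row set `R` and a
column set `C` with `|R| = |C|`, whose absolute determinant equals `Δ(G)`, and such that
every proper square submatrix has strictly smaller absolute determinant. -/
def IsMinimalWitness {V : Type*} (G : SimpleGraph V)
    (R C : Finset (V ⊕ G.edgeSet)) : Prop :=
  ∃ h : R.card = C.card,
    subdet G R C h = maxSubdet G ∧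
    ∀ (R' C' : Finset (V ⊕ G.edgeSet)) (h' : R'.card = C'.card),
      R' ⊆ R → C' ⊆ C → ¬(R' = R ∧ C' = C) → subdet G R' C' h' < maxSubdet G

open Matrix in
lemma subdet_eq_of_maps {V : Type*} (G : SimpleGraph V) (R C : Finset (V ⊕ G.edgeSet))
    (h : R.card = C.card) {k : ℕ} (f g : Fin k → (V ⊕ G.edgeSet))
    (hf : Function.Injective f) (hg : Function.Injective g)
    (hR : ∀ x, x ∈ R ↔ ∃ i, f i = x) (hC : ∀ x, x ∈ C ↔ ∃ i, g i = x) :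
    subdet G R C h = ((totalMatrix G).submatrix f g).det.natAbs := by
  let a : Fin k ≃ R := Equiv.ofBijective (fun i => ⟨f i, (hR _).2 ⟨i, rfl⟩⟩)
    ⟨fun i j hij => hf (congrArg Subtype.val hij),
     fun ⟨x, hx⟩ => by obtain ⟨i, hi⟩ := (hR x).1 hx; exact ⟨i, Subtype.ext hi⟩⟩
  let b : Fin k ≃ C := Equiv.ofBijective (fun i => ⟨g i, (hC _).2 ⟨i, rfl⟩⟩)
    ⟨fun i j hij => hg (congrArg Subtype.val hij),
     fun ⟨x, hx⟩ => by obtain ⟨i, hi⟩ := (hC x).1 hx; exact ⟨i, Subtype.ext hi⟩⟩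
  let e1 : Fin R.card ≃ Fin k := R.equivFin.symm.trans a.symm
  let e2 : Fin R.card ≃ Fin k := ((finCongr h).trans C.equivFin.symm).trans b.symm
  have key := Matrix.abs_det_submatrix_equiv_equiv e1 e2 ((totalMatrix G).submatrix f g)
  rw [Matrix.submatrix_submatrix] at key
  have hfa : f ∘ e1 = fun i : Fin R.card => (R.equivFin.symm i : V ⊕ G.edgeSet) := by
    funext i
    have : a (a.symm (R.equivFin.symm i)) = R.equivFin.symm i := a.apply_symm_apply _
    exact congrArg Subtype.val this
  have hgb : g ∘ e2 = fun i : Fin R.card =>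
      (C.equivFin.symm (Fin.cast h i) : V ⊕ G.edgeSet) := by
    funext i
    have : b (b.symm (C.equivFin.symm (Fin.cast h i))) = C.equivFin.symm (Fin.cast h i) :=
      b.apply_symm_apply _
    exact congrArg Subtype.val this
  rw [hfa, hgb] at key
  unfold subdet
  exact Int.natAbs_eq_natAbs_iff.2 (abs_eq_abs.1 key)

lemma totalMatrix_zero_or_one {V : Type*} (G : SimpleGraph V) (a b : V ⊕ G.edgeSet) :
    totalMatrix G a b = 0 ∨ totalMatrix G a b = 1 := by
  rcases a with a | a <;> rcases b with b | b <;> simp only [totalMatrix] <;> split_ifs <;> simp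

lemma totalMatrix_symm {V : Type*} (G : SimpleGraph V) (a b : V ⊕ G.edgeSet) :
    totalMatrix G a b = totalMatrix G b a := by
  rcases a with a | a <;> rcases b with b | b <;> simp only [totalMatrix, eq_comm]

lemma subdet_swap {V : Type*} (G : SimpleGraph V) (R C : Finset (V ⊕ G.edgeSet))
    (h : R.card = C.card) : subdet G R C h = subdet G C R h.symm := by
  rw [subdet_eq_of_maps G C R h.symm
    (fun i : Fin R.card => (C.equivFin.symm (Fin.cast h i) : V ⊕ G.edgeSet))
    (fun i : Fin R.card => (R.equivFin.symm i : V ⊕ G.edgeSet))]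
  · unfold subdet
    rw [← Matrix.det_transpose]
    congr 2
    ext i j
    exact totalMatrix_symm G _ _
  · intro i j hij
    simpa using hij
  · intro i j hij
    simpa using hij
  · intro x
    refine ⟨fun hx => ⟨Fin.cast h.symm (C.equivFin ⟨x, hx⟩), by simp⟩, ?_⟩
    rintro ⟨i, rfl⟩
    exact Subtype.prop _
  · intro x
    refine ⟨fun hx => ⟨R.equivFin ⟨x, hx⟩, by simp⟩, ?_⟩
    rintro ⟨i, rfl⟩
    exact Subtype.prop _

lemma IsMinimalWitness.swap {V : Type*} {G : SimpleGraph V} {R C : Finset (V ⊕ G.edgeSet)}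
    (hw : IsMinimalWitness G R C) : IsMinimalWitness G C R := by
  obtain ⟨h, h1, h2⟩ := hw
  refine ⟨h.symm, (subdet_swap G R C h).symm.trans h1, fun R' C' h' hR hC hne => ?_⟩
  rw [subdet_swap]
  exact h2 C' R' h'.symm hC hR (fun hh => hne ⟨hh.2, hh.1⟩)

/-- Two rows of a minimal witness differ in at least two columns. -/
lemma no_reduction {V : Type*} {G : SimpleGraph V} {R C : Finset (V ⊕ G.edgeSet)}
    (hw : IsMinimalWitness G R C) (r s c : V ⊕ G.edgeSet) (hr : r ∈ R) (hs : s ∈ R)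
    (hrs : r ≠ s) (hc : c ∈ C)
    (hz : ∀ y ∈ C, y ≠ c → totalMatrix G r y = totalMatrix G s y) : False := by
  obtain ⟨h, h1, h2⟩ := hw
  obtain ⟨n, hn⟩ : ∃ n, R.card = n + 1 :=
    Nat.exists_eq_succ_of_ne_zero (Finset.card_ne_zero_of_mem hr)
  have hn' : C.card = n + 1 := h ▸ hn
  let eR := R.equivFinOfCardEq hn
  let eC := C.equivFinOfCardEq hn'
  let f : Fin (n + 1) → V ⊕ G.edgeSet := fun i => (eR.symm i : V ⊕ G.edgeSet)
  let g : Fin (n + 1) → V ⊕ G.edgeSet := fun i => (eC.symm i : V ⊕ G.edgeSet)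
  have hf : Function.Injective f := fun i j hij => eR.symm.injective (Subtype.ext hij)
  have hg : Function.Injective g := fun i j hij => eC.symm.injective (Subtype.ext hij)
  have hR : ∀ x, x ∈ R ↔ ∃ i, f i = x := fun x =>
    ⟨fun hx => ⟨eR ⟨x, hx⟩, by simp [f]⟩, by rintro ⟨i, rfl⟩; exact Subtype.prop _⟩
  have hC : ∀ x, x ∈ C ↔ ∃ i, g i = x := fun x =>
    ⟨fun hx => ⟨eC ⟨x, hx⟩, by simp [g]⟩, by rintro ⟨i, rfl⟩; exact Subtype.prop _⟩
  obtain ⟨i0, hi0⟩ := (hR r).1 hr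
  obtain ⟨i1, hi1⟩ := (hR s).1 hs
  obtain ⟨j0, hj0⟩ := (hC c).1 hc
  have hi : i0 ≠ i1 := by rintro rfl; exact hrs (hi0.symm.trans hi1)
  have hcard : (R.erase r).card = (C.erase c).card := by
    rw [Finset.card_erase_of_mem hr, Finset.card_erase_of_mem hc, h]
  have hlt := h2 (R.erase r) (C.erase c) hcard (Finset.erase_subset _ _)
    (Finset.erase_subset _ _) (fun hh => Finset.notMem_erase r R (hh.1.symm ▸ hr))
  rw [← h1, subdet_eq_of_maps G R C h f g hf hg hR hC,
    subdet_eq_of_maps G (R.erase r) (C.erase c) hcard (f ∘ i0.succAbove) (g ∘ j0.succAbove)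
      (hf.comp Fin.succAbove_right_injective) (hg.comp Fin.succAbove_right_injective)] at hlt
  · set A := (totalMatrix G).submatrix f g with hA
    have hdet : A.det = (-1) ^ ((i0 : ℕ) + (j0 : ℕ)) * (totalMatrix G r c - totalMatrix G s c) *
        ((totalMatrix G).submatrix (f ∘ i0.succAbove) (g ∘ j0.succAbove)).det := by
      rw [← Matrix.det_updateRow_add_smul_self A hi (-1), Matrix.det_succ_row _ i0,
        Finset.sum_eq_single j0]
      · rw [Matrix.submatrix_updateRow_succAbove]
        simp [hA, hi0, hi1, hj0, sub_eq_add_neg, Matrix.submatrix_submatrix]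
      · intro j _ hj
        have := hz (g j) ((hC _).2 ⟨j, rfl⟩) (fun hh => hj (hg (hh.trans hj0.symm)))
        simp [hA, hi0, hi1, this]
      · simp
    have hle : (totalMatrix G r c - totalMatrix G s c).natAbs ≤ 1 := by
      rcases totalMatrix_zero_or_one G r c with h | h <;>
      rcases totalMatrix_zero_or_one G s c with h' | h' <;> simp [h, h']
    rw [hdet, Int.natAbs_mul, Int.natAbs_mul, Int.natAbs_pow] at hlt
    simp only [Int.natAbs_neg, Int.natAbs_one, one_pow, one_mul] at hlt
    have := Nat.mul_le_mul_right
      ((totalMatrix G).submatrix (f ∘ i0.succAbove) (g ∘ j0.succAbove)).det.natAbs hle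
    omega
  · intro x
    rw [Finset.mem_erase, hR]
    constructor
    · rintro ⟨hx, i, rfl⟩
      obtain ⟨k, hk⟩ := Fin.exists_succAbove_eq (x := i) (y := i0) (by rintro rfl; exact hx hi0)
      exact ⟨k, by simp [hk]⟩
    · rintro ⟨k, rfl⟩
      exact ⟨fun hh => Fin.succAbove_ne i0 k (hf (hh.trans hi0.symm)), _, rfl⟩
  · intro x
    rw [Finset.mem_erase, hC]
    constructor
    · rintro ⟨hx, i, rfl⟩
      obtain ⟨k, hk⟩ := Fin.exists_succAbove_eq (x := i) (y := j0) (by rintro rfl; exact hx hj0)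
      exact ⟨k, by simp [hk]⟩
    · rintro ⟨k, rfl⟩
      exact ⟨fun hh => Fin.succAbove_ne j0 k (hg (hh.trans hj0.symm)), _, rfl⟩

lemma totalMatrix_congr {V : Type*} {G : SimpleGraph V} {r s y : V ⊕ G.edgeSet}
    (h : Incid G r y ↔ Incid G s y) : totalMatrix G r y = totalMatrix G s y := by
  unfold Incid at h
  rcases totalMatrix_zero_or_one G r y with h1 | h1 <;>
  rcases totalMatrix_zero_or_one G s y with h2 | h2 <;> simp_all

lemma row_version {V : Type*} {G : SimpleGraph V}
    {x0 x1 x2 x3 x4 : V ⊕ G.edgeSet}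
    (h12 : x1 ≠ x2) (h23 : x2 ≠ x3)
    (hx1 : ∀ y, Incid G x1 y ↔ (y = x0 ∨ y = x1 ∨ y = x2))
    (hx2 : ∀ y, Incid G x2 y ↔ (y = x1 ∨ y = x2 ∨ y = x3))
    (hx3 : ∀ y, Incid G x3 y ↔ (y = x2 ∨ y = x3 ∨ y = x4))
    {R C : Finset (V ⊕ G.edgeSet)} (hw : IsMinimalWitness G R C)
    (hC2 : x2 ∈ C) (hR1 : x1 ∈ R) (hR2 : x2 ∈ R) (hR3 : x3 ∈ R) :
    x0 ∈ C ∧ x1 ∈ C ∧ x2 ∈ C ∧ x3 ∈ C ∧ x4 ∈ C := by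
  have a1 : x1 ∈ C := by
    by_contra hn
    by_cases h4 : x4 ∈ C
    · exact no_reduction hw x3 x2 x4 hR3 hR2 h23.symm h4 (fun y hy hne =>
        totalMatrix_congr (by rw [hx2, hx3]; grind))
    · exact no_reduction hw x3 x2 x2 hR3 hR2 h23.symm hC2 (fun y hy hne =>
        totalMatrix_congr (by rw [hx2, hx3]; grind))
  have a3 : x3 ∈ C := by
    by_contra hn
    by_cases h0 : x0 ∈ C
    · exact no_reduction hw x1 x2 x0 hR1 hR2 h12 h0 (fun y hy hne =>
        totalMatrix_congr (by rw [hx2, hx1]; grind))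
    · exact no_reduction hw x1 x2 x2 hR1 hR2 h12 hC2 (fun y hy hne =>
        totalMatrix_congr (by rw [hx2, hx1]; grind))
  refine ⟨?_, a1, hC2, a3, ?_⟩
  · by_contra hn
    exact no_reduction hw x2 x1 x3 hR2 hR1 h12.symm a3 (fun y hy hne =>
        totalMatrix_congr (by rw [hx2, hx1]; grind))
  · by_contra hn
    exact no_reduction hw x2 x3 x1 hR2 hR3 h23 a1 (fun y hy hne =>
        totalMatrix_congr (by rw [hx2, hx3]; grind))

/-- Lemma on minimal witnesses, part (ii): with `x₀, …, x₄` as before (each `xᵢ`,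
`i ∈ {1,2,3}`, incident exactly to `x_{i-1}, x_i, x_{i+1}`; possibly `x₀ = x₄`, otherwise
pairwise distinct) and `(R, C)` a minimal witness: if `x₂` is bicolored and `x₁, x₂, x₃`
all lie in `R`, then all of `x₀, …, x₄` lie in `C`; symmetrically with `R` and `C`
interchanged. -/
theorem stmt7 {V : Type*} [Fintype V] (G : SimpleGraph V)
    (x0 x1 x2 x3 x4 : V ⊕ G.edgeSet)
    (h01 : x0 ≠ x1) (h02 : x0 ≠ x2) (h03 : x0 ≠ x3)
    (h12 : x1 ≠ x2) (h13 : x1 ≠ x3) (h14 : x1 ≠ x4)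
    (h23 : x2 ≠ x3) (h24 : x2 ≠ x4) (h34 : x3 ≠ x4)
    (hx1 : ∀ y, Incid G x1 y ↔ (y = x0 ∨ y = x1 ∨ y = x2))
    (hx2 : ∀ y, Incid G x2 y ↔ (y = x1 ∨ y = x2 ∨ y = x3))
    (hx3 : ∀ y, Incid G x3 y ↔ (y = x2 ∨ y = x3 ∨ y = x4))
    (R C : Finset (V ⊕ G.edgeSet)) (hw : IsMinimalWitness G R C) :
    ((x2 ∈ R ∧ x2 ∈ C) → x1 ∈ R → x2 ∈ R → x3 ∈ R →
      x0 ∈ C ∧ x1 ∈ C ∧ x2 ∈ C ∧ x3 ∈ C ∧ x4 ∈ C) ∧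
    ((x2 ∈ R ∧ x2 ∈ C) → x1 ∈ C → x2 ∈ C → x3 ∈ C →
      x0 ∈ R ∧ x1 ∈ R ∧ x2 ∈ R ∧ x3 ∈ R ∧ x4 ∈ R) := by
  exact ⟨fun h hR1 hR2 hR3 => row_version h12 h23 hx1 hx2 hx3 hw h.2 hR1 hR2 hR3,
    fun h hC1 hC2 hC3 => row_version h12 h23 hx1 hx2 hx3 hw.swap h.1 hC1 hC2 hC3⟩
end

section
/- Let G be a cycle on n ≥ 3 vertices. Then Δ(G) = 3 if n ≡ 1 or 2 (mod 3), and Δ(G) = 2 if n ≡ 0 (mod 3). -/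
open scoped Classical

namespace CycleDet

lemma opt_pull {α β : Type*} (h : α → β) (hh : Function.Injective h) (s : Option β) :
    ∃ s' : Option α, ∀ j, (s = some (h j)) ↔ (s' = some j) := by
  by_cases H : ∃ j, s = some (h j)
  · obtain ⟨j, hj⟩ := H
    refine ⟨some j, fun j' => ?_⟩
    rw [hj]
    simp [hh.eq_iff]
  · refine ⟨none, fun j => ?_⟩
    simp only [reduceCtorEq, iff_false]
    exact fun h' => H ⟨j, h'⟩

/-- network type matrices have determinant at most one -/
lemma det_network (n : ℕ) : ∀ (A : Matrix (Fin n) (Fin n) ℤ),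
    (∀ i, ∃ s t : Option (Fin n), ∀ j, A i j =
      (if s = some j then 1 else 0) - (if t = some j then 1 else 0)) → |A.det| ≤ 1 := by
  induction n with
  | zero => intro A _; simp
  | succ n ih =>
    intro A hA
    by_cases H : ∃ i j0, (∀ j, j ≠ j0 → A i j = 0) ∧ |A i j0| ≤ 1
    · obtain ⟨i, j0, h0, h1⟩ := H
      rw [Matrix.det_succ_row A i, Finset.sum_eq_single j0]
      · rw [abs_mul, abs_mul, abs_pow]
        have : |(A.submatrix i.succAbove j0.succAbove).det| ≤ 1 := by
          apply ih
          intro i'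
          obtain ⟨s, t, hst⟩ := hA (i.succAbove i')
          obtain ⟨s', hs'⟩ := opt_pull j0.succAbove Fin.succAbove_right_injective s
          obtain ⟨t', ht'⟩ := opt_pull j0.succAbove Fin.succAbove_right_injective t
          refine ⟨s', t', fun j => ?_⟩
          rw [Matrix.submatrix_apply, hst]
          simp only [hs', ht']
        simp only [abs_neg, abs_one, one_pow, one_mul]
        exact mul_le_one₀ h1 (abs_nonneg _) this
      · intro j _ hj
        rw [h0 j hj]; ring
      · simp
    · have hz : A.det = 0 := by
        rw [← Matrix.exists_mulVec_eq_zero_iff]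
        refine ⟨fun _ => 1, ?_, ?_⟩
        · intro h
          have := congrFun h 0
          simp at this
        · funext i
          simp only [Matrix.mulVec, dotProduct, mul_one, Pi.zero_apply]
          obtain ⟨s, t, hst⟩ := hA i
          simp only [hst, Finset.sum_sub_distrib]
          rcases s with _ | s <;> rcases t with _ | t
          · simp
          · exfalso; apply H
            refine ⟨i, t, fun j hj => ?_, ?_⟩
            · rw [hst]; simp [Ne.symm hj]
            · rw [hst]; simp
          · exfalso; apply H
            refine ⟨i, s, fun j hj => ?_, ?_⟩
            · rw [hst]; simp [Ne.symm hj]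
            · rw [hst]; simp
          · simp
      rw [hz]; simp

/-- A row is good if its consecutive differences have at most one `1` and at most one `-1`. -/
def Good {m : ℕ} (v : Fin (m + 1) → ℤ) : Prop :=
  ∃ s t : ℕ, ∀ j : Fin m, v j.succ - v j.castSucc =
    (if (j : ℕ) + 1 = s then 1 else 0) - (if (j : ℕ) + 1 = t then 1 else 0)

lemma opt_nat (m s : ℕ) : ∃ s' : Option (Fin m), ∀ j : Fin m,
    ((j : ℕ) + 1 = s) ↔ (s' = some j) := by
  by_cases H : ∃ j : Fin m, (j : ℕ) + 1 = s
  · obtain ⟨j, hj⟩ := H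
    refine ⟨some j, fun j' => ?_⟩
    rw [← hj]
    simp only [Option.some.injEq, Fin.ext_iff]
    omega
  · refine ⟨none, fun j => ?_⟩
    simp only [reduceCtorEq, iff_false]
    exact fun h' => H ⟨j, h'⟩

lemma det_updateRow_le {m : ℕ} (A : Matrix (Fin (m + 1)) (Fin (m + 1)) ℤ)
    (hA : ∀ i, Good (A i)) (i : Fin (m + 1)) :
    |(A.updateRow i (fun _ => 1)).det| ≤ 1 := by
  set B := A.updateRow i (fun _ => 1) with hB
  let D : Matrix (Fin (m + 1)) (Fin (m + 1)) ℤ := fun r c =>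
    Fin.cases (motive := fun _ => ℤ) (B r 0) (fun j => B r j.succ - B r j.castSucc) c
  have hD0 : ∀ r, D r 0 = B r 0 := fun r => rfl
  have hDs : ∀ r (j : Fin m), D r j.succ = B r j.succ - B r j.castSucc := fun r j => rfl
  have hdet : D.det = B.det := by
    symm
    -- B is obtained from D by adding previous columns
    apply Matrix.det_eq_of_forall_col_eq_smul_add_pred (fun _ => (1 : ℤ))
    · intro r; exact (hD0 r).symm
    · intro r j; rw [hDs]; ring
  rw [← hdet, Matrix.det_succ_row D i, Finset.sum_eq_single 0]
  · rw [hD0, abs_mul, abs_mul, abs_pow]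
    have h1 : B i 0 = 1 := by simp [hB]
    rw [h1]
    simp only [abs_neg, abs_one, one_pow, one_mul]
    apply det_network
    intro i'
    obtain ⟨s, t, hst⟩ := hA (i.succAbove i')
    obtain ⟨s', hs'⟩ := opt_nat m s
    obtain ⟨t', ht'⟩ := opt_nat m t
    refine ⟨s', t', fun j => ?_⟩
    rw [Matrix.submatrix_apply, Fin.succAbove_zero, hDs]
    have : B (i.succAbove i') = A (i.succAbove i') := by
      rw [hB]; exact Matrix.updateRow_ne (Fin.succAbove_ne i i')
    rw [this, hst]
    simp only [hs', ht']
  · intro j _ hj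
    obtain ⟨j', rfl⟩ := Fin.exists_succ_eq.mpr hj
    rw [hDs]
    simp [hB]
  · simp

lemma det_bound {m : ℕ} (A : Matrix (Fin (m + 1)) (Fin (m + 1)) ℤ)
    (hA : ∀ i, Good (A i)) :
    ((m : ℤ) + 1) * |A.det| ≤ ∑ i, |∑ j, A i j| := by
  have h := Matrix.mulVec_cramer A.transpose (fun _ => (1 : ℤ))
  have h2 : ∑ i, (∑ j, A i j) * (A.updateRow i (fun _ => 1)).det = ((m : ℤ) + 1) * A.det := by
    calc _ = ∑ j, ∑ i, A i j * (A.updateRow i (fun _ => 1)).det := by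
          rw [Finset.sum_comm]; simp only [Finset.sum_mul]
      _ = ∑ j : Fin (m + 1), A.det := by
          apply Finset.sum_congr rfl
          intro j _
          have := congrFun h j
          simpa [Matrix.mulVec, dotProduct, Matrix.cramer_transpose_apply] using this
      _ = _ := by simp
  have hm : |((m : ℤ) + 1)| = (m : ℤ) + 1 := abs_of_nonneg (by positivity)
  calc ((m : ℤ) + 1) * |A.det| = |((m : ℤ) + 1) * A.det| := by rw [abs_mul, hm]
    _ ≤ ∑ i, |(∑ j, A i j) * (A.updateRow i (fun _ => 1)).det| := by
        rw [← h2]; exact Finset.abs_sum_le_sum_abs _ _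
    _ ≤ _ := by
        apply Finset.sum_le_sum
        intro i _
        rw [abs_mul]
        exact mul_le_of_le_one_right (abs_nonneg _) (det_updateRow_le A hA i)

lemma dvd_det {k : ℕ} (hk : 0 < k) (A : Matrix (Fin k) (Fin k) ℤ) (d : ℤ)
    (h : ∀ i, ∑ j, A i j = d) : d ∣ A.det := by
  have h1 : A.mulVec (fun _ => 1) = fun _ => d := by
    funext i; simp [Matrix.mulVec, dotProduct, h]
  have h2 : A.adjugate.mulVec (A.mulVec (fun _ => 1)) = A.det • (fun _ => (1:ℤ)) := by
    rw [Matrix.mulVec_mulVec, Matrix.adjugate_mul, Matrix.smul_mulVec, Matrix.one_mulVec]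
  rw [h1] at h2
  have h3 := congrFun h2 ⟨0, hk⟩
  simp only [Matrix.mulVec, dotProduct, ← Finset.sum_mul, Pi.smul_apply, smul_eq_mul, mul_one] at h3
  rw [← h3]
  exact Dvd.intro_left _ rfl

/-- predecessor and successor on the cycle, and the circulant matrix -/
def prv {m : ℕ} (i : Fin (m + 1)) : Fin (m + 1) :=
  if h : (i : ℕ) = 0 then ⟨m, by omega⟩ else ⟨(i : ℕ) - 1, by omega⟩

def nxt {m : ℕ} (i : Fin (m + 1)) : Fin (m + 1) :=
  if h : (i : ℕ) = m then ⟨0, by omega⟩ else ⟨(i : ℕ) + 1, by omega⟩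

lemma prv_val {m : ℕ} (i : Fin (m + 1)) :
    (prv i : ℕ) = if (i : ℕ) = 0 then m else (i : ℕ) - 1 := by
  unfold prv; split_ifs <;> rfl

lemma nxt_val {m : ℕ} (i : Fin (m + 1)) :
    (nxt i : ℕ) = if (i : ℕ) = m then 0 else (i : ℕ) + 1 := by
  unfold nxt; split_ifs <;> rfl

def circ (m : ℕ) : Matrix (Fin (m + 1)) (Fin (m + 1)) ℤ := fun i j =>
  if j = prv i ∨ j = i ∨ j = nxt i then 1 else 0

lemma circ_eq {m : ℕ} (hm : 2 ≤ m) (i j : Fin (m + 1)) :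
    circ m i j = (if j = prv i then 1 else 0) + (if j = i then 1 else 0)
      + (if j = nxt i then 1 else 0) := by
  have h1 := prv_val i
  have h2 := nxt_val i
  have hi := i.isLt
  unfold circ
  simp only [Fin.ext_iff]
  split_ifs at * <;> first | rfl | omega

lemma circ_sum {m : ℕ} (hm : 2 ≤ m) (i : Fin (m + 1)) (v : Fin (m + 1) → ℤ) :
    ∑ j, circ m i j * v j = v (prv i) + v i + v (nxt i) := by
  simp only [circ_eq hm, add_mul, Finset.sum_add_distrib, ite_mul, one_mul, zero_mul]
  simp

lemma circ_good {m : ℕ} (hm : 3 ≤ m) (i : Fin (m + 1)) : Good (circ m i) := by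
  have h1 := prv_val i
  have h2 := nxt_val i
  have hi := i.isLt
  refine ⟨prv i, if (i : ℕ) = m then 1 else if (i : ℕ) + 1 = m then 0 else i + 2, fun j => ?_⟩
  have hj := j.isLt
  unfold circ
  simp only [Fin.ext_iff, Fin.val_succ, Fin.val_castSucc]
  split_ifs at * <;> first | rfl | omega

lemma unit_good {m : ℕ} (c : Fin (m + 1)) : Good (fun j => if c = j then (1 : ℤ) else 0) := by
  refine ⟨c, c + 1, fun j => ?_⟩
  simp only [Fin.ext_iff, Fin.val_succ, Fin.val_castSucc]
  split_ifs at * <;> first | rfl | omega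

lemma circ_det_zero {m : ℕ} (hm : 3 ≤ m) (h3 : (m + 1) % 3 = 0)
    (A : Matrix (Fin (m + 1)) (Fin (m + 1)) ℤ) (hA : ∀ i, ∃ r, A i = circ m r) : A.det = 0 := by
  rw [← Matrix.exists_mulVec_eq_zero_iff]
  refine ⟨fun j => if (j : ℕ) % 3 = 0 then 1 else if (j : ℕ) % 3 = 1 then -1 else 0, ?_, ?_⟩
  · intro h
    have := congrFun h 0
    simp at this
  · funext i
    obtain ⟨r, hr⟩ := hA i
    simp only [Matrix.mulVec, dotProduct, hr, Pi.zero_apply]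
    rw [circ_sum (by omega)]
    have h1 := prv_val r
    have h2 := nxt_val r
    have hi := r.isLt
    split_ifs at * <;> first | rfl | omega

lemma sub_bound {m : ℕ} (hm : 3 ≤ m) {k : ℕ} (f g : Fin k → Fin (m + 1))
    (hg : Function.Injective g) :
    |((circ m).submatrix f g).det| ≤ 3 ∧
      ((m + 1) % 3 = 0 → |((circ m).submatrix f g).det| ≤ 2) := by
  let e : Fin k ⊕ ((Set.range g)ᶜ : Set (Fin (m + 1))) ≃ Fin (m + 1) :=
    (Equiv.sumCongr (Equiv.ofInjective g hg) (Equiv.refl _)).trans (Equiv.Set.sumCompl _)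
  have he1 : ∀ i, e (Sum.inl i) = g i := fun i => by simp [e]
  have he2 : ∀ c, e (Sum.inr c) = c := fun c => by simp [e]
  let M' : Fin k ⊕ ((Set.range g)ᶜ : Set (Fin (m + 1))) → Fin (m + 1) → ℤ :=
    Sum.elim (fun i => circ m (f i)) (fun c j => if (c : Fin (m + 1)) = j then 1 else 0)
  let A : Matrix (Fin (m + 1)) (Fin (m + 1)) ℤ := fun x j => M' (e.symm x) j
  have hA : ∀ a j, A (e a) j = M' a j := fun a j => by simp [A]
  have hdet : A.det = ((circ m).submatrix f g).det := by
    rw [← Matrix.det_submatrix_equiv_self e A]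
    have : A.submatrix e e = Matrix.fromBlocks ((circ m).submatrix f g)
        ((circ m).submatrix f (fun c : ((Set.range g)ᶜ : Set (Fin (m + 1))) => (c : Fin (m + 1)))) 0 1 := by
      ext a b
      rw [Matrix.submatrix_apply, hA]
      rcases a with a | a <;> rcases b with b | b
      · simp [M', he1]
      · simp [M', he2]
      · have : (a : Fin (m + 1)) ≠ g b := fun h => a.2 ⟨b, h.symm⟩
        simp [M', he1, this]
      · simp [M', he2, Matrix.one_apply, Subtype.ext_iff]
    rw [this, Matrix.det_fromBlocks_zero₂₁, Matrix.det_one, mul_one]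
  have hgood : ∀ i, Good (A i) := by
    intro i
    change Good (M' (e.symm i))
    rcases e.symm i with a | a
    · exact circ_good hm _
    · exact unit_good _
  have hs1 : ∀ r, ∑ j, circ m r j = 3 := by
    intro r
    have := circ_sum (by omega : 2 ≤ m) r (fun _ => 1)
    simpa using this
  have hsum : ∀ i, |∑ j, A i j| ≤ 3 ∧ ((∀ r, A i ≠ circ m r) → |∑ j, A i j| < 3) := by
    intro i
    change |∑ j, M' (e.symm i) j| ≤ 3 ∧ ((∀ r, M' (e.symm i) ≠ circ m r) →
      |∑ j, M' (e.symm i) j| < 3)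
    rcases e.symm i with a | a
    · refine ⟨?_, fun h => absurd rfl (h (f a))⟩
      simp [M', hs1]
    · simp [M']
  have hb := det_bound A hgood
  rw [← hdet]
  have h3 : ∑ i : Fin (m + 1), (3 : ℤ) = ((m : ℤ) + 1) * 3 := by simp
  have hmp : (0 : ℤ) < (m : ℤ) + 1 := by positivity
  constructor
  · have : ∑ i, |∑ j, A i j| ≤ ∑ i : Fin (m + 1), (3 : ℤ) :=
      Finset.sum_le_sum (fun i _ => (hsum i).1)
    rw [h3] at this
    exact le_of_mul_le_mul_left (hb.trans this) hmp
  · intro hmod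
    by_cases H : ∀ i, ∃ r, A i = circ m r
    · rw [circ_det_zero hm hmod A H]; simp
    · push Not at H
      obtain ⟨i, hi⟩ := H
      have : ∑ i, |∑ j, A i j| < ∑ i : Fin (m + 1), (3 : ℤ) :=
        Finset.sum_lt_sum (fun i _ => (hsum i).1) ⟨i, Finset.mem_univ _, (hsum i).2 hi⟩
      rw [h3] at this
      have := lt_of_mul_lt_mul_left (hb.trans_lt this) hmp.le
      omega

lemma per_mul (w : ℕ → ℤ) (p : ℕ) (h : ∀ i, w (i + p) = w i) (q i : ℕ) :
    w (i + p * q) = w i := by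
  induction q with
  | zero => simp
  | succ q ih => rw [Nat.mul_succ, ← Nat.add_assoc, h, ih]

lemma circ_det_ne {m : ℕ} (hm : 3 ≤ m) (h3 : (m + 1) % 3 ≠ 0) : (circ m).det ≠ 0 := by
  intro h
  rw [← Matrix.exists_mulVec_eq_zero_iff] at h
  obtain ⟨v, hv, h⟩ := h
  apply hv
  let w : ℕ → ℤ := fun i => v ⟨i % (m + 1), Nat.mod_lt _ (by omega)⟩
  have hN : ∀ i, w (i + (m + 1)) = w i := by intro i; simp [w]
  have hw : ∀ i, w i + w (i + 1) + w (i + 2) = 0 := by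
    intro i
    have := congrFun h ⟨(i + 1) % (m + 1), Nat.mod_lt _ (by omega)⟩
    simp only [Matrix.mulVec, dotProduct, Pi.zero_apply] at this
    rw [circ_sum (by omega)] at this
    rw [← this]
    have hlt := Nat.mod_lt i (show m + 1 > 0 by omega)
    have e1 : (i + 1) % (m + 1) = if i % (m + 1) = m then 0 else i % (m + 1) + 1 := by
      rw [Nat.add_mod_eq_ite, Nat.mod_eq_of_lt (show 1 < m + 1 by omega)]
      split_ifs <;> omega
    have e2 : (i + 2) % (m + 1) = if (i + 1) % (m + 1) = m then 0 else (i + 1) % (m + 1) + 1 := by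
      have := Nat.mod_lt (i + 1) (show m + 1 > 0 by omega)
      rw [show i + 2 = (i + 1) + 1 from rfl, Nat.add_mod_eq_ite,
        Nat.mod_eq_of_lt (show 1 < m + 1 by omega)]
      split_ifs <;> omega
    congr 1
    · congr 1
      simp only [w]
      congr 1
      ext
      rw [prv_val]
      simp only [e1]
      by_cases hc : i % (m + 1) = m
      · simp [hc]
      · simp [hc]
    · simp only [w]
      congr 1
      ext
      rw [nxt_val]
      simp only [e2]
  have hp : ∀ i, w (i + 3) = w i := by
    intro i
    have := hw i
    have := hw (i + 1)
    simp only [Nat.add_assoc, Nat.reduceAdd] at *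
    linarith
  have hc : ∀ i, w (i + 1) = w i := by
    intro i
    have hq := fun i => per_mul w 3 hp ((m + 1) / 3) i
    rcases (by omega : (m + 1) % 3 = 1 ∨ (m + 1) % 3 = 2) with h | h
    · rw [← hN i, ← hq (i + 1)]; congr 1; omega
    · have h1 := hN (i + 1)
      have h2 := hq (i + 3)
      rw [show i + 3 + 3 * ((m + 1) / 3) = i + 1 + (m + 1) by omega, h1, hp] at h2
      exact h2
  funext i
  have h0 : w i = v i := by
    simp only [w]; congr 1; ext; exact Nat.mod_eq_of_lt i.isLt
  have := hw i
  have := hc i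
  have := hc (i + 1)
  simp only [Nat.add_assoc, Nat.reduceAdd] at *
  simp only [Pi.zero_apply]
  linarith

lemma exists_three {m : ℕ} (hm : 3 ≤ m) (h3 : (m + 1) % 3 ≠ 0) :
    |(circ m).det| = 3 := by
  have hne := circ_det_ne hm h3
  have hd : (3 : ℤ) ∣ (circ m).det := by
    apply dvd_det (by omega)
    intro r
    have := circ_sum (by omega : 2 ≤ m) r (fun _ => 1)
    simpa using this
  have hb := (sub_bound hm (id : Fin (m + 1) → _) id Function.injective_id).1
  rw [Matrix.submatrix_id_id] at hb
  rw [abs_le] at hb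
  rcases abs_cases (circ m).det with h | h <;> omega

lemma nxt_mod {l : ℕ} (i : ℕ) :
    nxt (⟨i % (l + 1), Nat.mod_lt _ (by omega)⟩ : Fin (l + 1)) =
      ⟨(i + 1) % (l + 1), Nat.mod_lt _ (by omega)⟩ := by
  ext
  rw [nxt_val]
  have hlt := Nat.mod_lt i (show l + 1 > 0 by omega)
  rcases Nat.eq_zero_or_pos l with rfl | hl
  · simp [Nat.mod_one]
  simp only
  rw [Nat.add_mod_eq_ite, Nat.mod_eq_of_lt (show 1 < l + 1 by omega)]
  split_ifs <;> omega

lemma nxt_inj {l : ℕ} : Function.Injective (nxt : Fin (l + 1) → Fin (l + 1)) := by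
  intro a b h
  have h1 := nxt_val a
  have h2 := nxt_val b
  rw [h] at h1
  ext
  split_ifs at * <;> omega

lemma nxt_or {l : ℕ} (i : Fin (l + 1)) :
    ((i : ℕ) = l ∧ (nxt i : ℕ) = 0) ∨ ((i : ℕ) < l ∧ (nxt i : ℕ) = i + 1) := by
  have h1 := nxt_val i
  have := i.isLt
  split_ifs at * <;> omega

lemma prv_or {l : ℕ} (i : Fin (l + 1)) :
    ((i : ℕ) = 0 ∧ (prv i : ℕ) = l) ∨ (0 < (i : ℕ) ∧ (prv i : ℕ) + 1 = i) := by
  have h1 := prv_val i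
  split_ifs at * <;> omega

/-- The incidence matrix of an odd cycle. -/
lemma odd_cycle {l : ℕ} (hl : 1 ≤ l) (hodd : (l + 1) % 2 = 1)
    (A : Matrix (Fin (l + 1)) (Fin (l + 1)) ℤ)
    (hA : ∀ i j, A i j = if j = i ∨ j = nxt i then 1 else 0) :
    A.det ≠ 0 ∧ (2 : ℤ) ∣ A.det := by
  have hs : ∀ i (v : Fin (l + 1) → ℤ), ∑ j, A i j * v j = v i + v (nxt i) := by
    intro i v
    have : ∀ j, A i j = (if j = i then 1 else 0) + (if j = nxt i then 1 else 0) := by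
      intro j
      rw [hA]
      have h2 := nxt_val i
      simp only [Fin.ext_iff]
      split_ifs at * <;> first | rfl | omega
    simp only [this, add_mul, Finset.sum_add_distrib, ite_mul, one_mul, zero_mul]
    simp
  constructor
  · intro h
    rw [← Matrix.exists_mulVec_eq_zero_iff] at h
    obtain ⟨v, hv, h⟩ := h
    apply hv
    let w : ℕ → ℤ := fun i => v ⟨i % (l + 1), Nat.mod_lt _ (by omega)⟩
    have hN : ∀ i, w (i + (l + 1)) = w i := by intro i; simp [w]
    have hw : ∀ i, w i + w (i + 1) = 0 := by
      intro i
      have := congrFun h ⟨i % (l + 1), Nat.mod_lt _ (by omega)⟩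
      simp only [Matrix.mulVec, dotProduct, Pi.zero_apply] at this
      rw [hs, nxt_mod] at this
      exact this
    have hp : ∀ i, w (i + 2) = w i := by
      intro i
      have := hw i
      have := hw (i + 1)
      simp only [Nat.add_assoc, Nat.reduceAdd] at *
      linarith
    funext i
    have h0 : w i = v i := by
      simp only [w]; congr 1; ext; exact Nat.mod_eq_of_lt i.isLt
    have h1 := hN i
    have h2 := per_mul w 2 hp ((l + 1) / 2) (i + 1)
    rw [show (i : ℕ) + 1 + 2 * ((l + 1) / 2) = i + (l + 1) by omega, h1] at h2
    have := hw i
    simp only [Pi.zero_apply]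
    linarith
  · apply dvd_det (by omega)
    intro i
    have := hs i (fun _ => 1)
    simpa using this

lemma exists_two_aux {m l : ℕ} (hm : 3 ≤ m) (h3 : (m + 1) % 3 = 0) (hl : 1 ≤ l)
    (hodd : (l + 1) % 2 = 1) (g : Fin (l + 1) → Fin (m + 1)) (hg : Function.Injective g)
    (hc : ∀ i j, (g j = g i ∨ g j = nxt (g i) ∨ g j = nxt (nxt (g i))) ↔ (j = i ∨ j = nxt i)) :
    ∃ (k : ℕ) (f g : Fin k → Fin (m + 1)), Function.Injective f ∧ Function.Injective g ∧
      |((circ m).submatrix f g).det| = 2 := by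
  refine ⟨l + 1, nxt ∘ g, g, nxt_inj.comp hg, hg, ?_⟩
  have hb := (sub_bound hm (nxt ∘ g) g hg).2 h3
  obtain ⟨h1, h2⟩ := odd_cycle hl hodd ((circ m).submatrix (nxt ∘ g) g) (by
    intro i j
    have hp : prv (nxt (g i)) = g i := by
      ext
      have h1 := nxt_val (g i)
      have h2 := prv_val (nxt (g i))
      split_ifs at * <;> omega
    simp only [Matrix.submatrix_apply, circ, Function.comp, hp, hc])
  rw [abs_le] at hb
  rcases abs_cases ((circ m).submatrix (nxt ∘ g) g).det with h | h <;> omega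

lemma exists_two {m n : ℕ} (hn : 3 ≤ n) (hmn : m + 1 = 2 * n) (h3 : n % 3 = 0) :
    ∃ (k : ℕ) (f g : Fin k → Fin (m + 1)), Function.Injective f ∧ Function.Injective g ∧
      |((circ m).submatrix f g).det| = 2 := by
  rcases Nat.even_or_odd' n with ⟨c, hc | hc⟩
  · have hlt : ∀ j : Fin (n + 1), (if (j : ℕ) = 0 then 0 else if (j : ℕ) ≤ 2 then 2 * (j : ℕ) - 1
        else 2 * j - 2) < m + 1 := by
      intro j
      have := j.isLt
      split_ifs <;> omega
    obtain ⟨g, hgv⟩ : ∃ g : Fin (n + 1) → Fin (m + 1), ∀ j, (g j : ℕ) = if (j : ℕ) = 0 then 0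
        else if (j : ℕ) ≤ 2 then 2 * (j : ℕ) - 1 else 2 * j - 2 := ⟨fun j => ⟨_, hlt j⟩, fun _ => rfl⟩
    have hgo : ∀ j : Fin (n + 1), ((j : ℕ) = 0 ∧ (g j : ℕ) = 0) ∨ ((j : ℕ) = 1 ∧ (g j : ℕ) = 1) ∨
        ((j : ℕ) = 2 ∧ (g j : ℕ) = 3) ∨ (3 ≤ (j : ℕ) ∧ (g j : ℕ) + 2 = 2 * j) := by
      intro j
      have := hgv j
      split_ifs at this <;> omega
    refine exists_two_aux (l := n) (by omega) (by omega) (by omega) (by omega) g ?_ ?_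
    · intro i j h
      have h1 := hgo i
      have h2 := hgo j
      rw [Fin.ext_iff] at h ⊢
      omega
    · intro i j
      have hi := i.isLt
      have hj := j.isLt
      have h1 := hgo i
      have h2 := hgo j
      have h3 := nxt_or i
      have h4 := nxt_or (g i)
      have h5 := nxt_or (nxt (g i))
      have hn6 : 6 ≤ n := by omega
      simp only [Fin.ext_iff]
      omega
  · have hlt : ∀ j : Fin (2 * c + 1), 2 * (j : ℕ) < m + 1 := by
      intro j
      have := j.isLt
      omega
    refine exists_two_aux (l := 2 * c) (by omega) (by omega) (by omega) (by omega)
      (fun j => ⟨_, hlt j⟩) ?_ ?_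
    · intro i j h
      simp only [Fin.ext_iff] at h ⊢
      omega
    · intro i j
      have hi := i.isLt
      have hj := j.isLt
      simp only [Fin.ext_iff, nxt_val]
      split_ifs <;> omega

lemma cycle_adj {l : ℕ} (hl : 2 ≤ l) (u v : Fin (l + 1)) :
    (SimpleGraph.cycleGraph (l + 1)).Adj u v ↔ v = nxt u ∨ u = nxt v := by
  rw [SimpleGraph.cycleGraph_adj']
  have hu := u.isLt
  have hv := v.isLt
  simp only [Fin.ext_iff, nxt_val, Fin.val_sub]
  have e : ∀ a b : ℕ, a < l + 1 → b < l + 1 →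
      (l + 1 - b + a) % (l + 1) = if b ≤ a then a - b else l + 1 - b + a := by
    intro a b ha hb
    split_ifs with h
    · rw [show l + 1 - b + a = (a - b) + (l + 1) by omega, Nat.add_mod_right,
        Nat.mod_eq_of_lt (by omega)]
    · rw [Nat.mod_eq_of_lt (by omega)]
  rw [e _ _ hu hv, e _ _ hv hu]
  split_ifs <;> omega

lemma exists_param {V : Type*} (G : SimpleGraph V) {l m : ℕ} (hl : 2 ≤ l)
    (hm : m + 1 = 2 * (l + 1)) (h : G ≃g SimpleGraph.cycleGraph (l + 1)) :
    ∃ φ : Fin (m + 1) → V ⊕ G.edgeSet, Function.Bijective φ ∧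
      ∀ a b, totalMatrix G (φ a) (φ b) = circ m a b := by
  have hadj : ∀ i, G.Adj (h.symm i) (h.symm (nxt i)) := by
    intro i
    rw [h.symm.map_adj_iff, cycle_adj hl]
    exact Or.inl rfl
  let ev : Fin (l + 1) → V ⊕ G.edgeSet := fun i => Sum.inl (h.symm i)
  let ed : Fin (l + 1) → V ⊕ G.edgeSet := fun i => Sum.inr ⟨s(h.symm i, h.symm (nxt i)), hadj i⟩
  have evinj : ∀ i j, ev i = ev j ↔ i = j := by
    intro i j; simp [ev]
  have edinj : ∀ i j, ed i = ed j ↔ i = j := by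
    intro i j
    have h1 := nxt_val i
    have h2 := nxt_val j
    have h3 : ed i = ed j ↔ (i = j ∧ nxt i = nxt j ∨ i = nxt j ∧ nxt i = j) := by
      refine (Sum.inr_injective.eq_iff).trans (Subtype.ext_iff.trans ?_)
      change s(h.symm i, h.symm (nxt i)) = s(h.symm j, h.symm (nxt j)) ↔ _
      rw [Sym2.eq_iff]
      simp
    rw [h3]
    simp only [Fin.ext_iff]
    split_ifs at * <;> omega
  have surj : ∀ x, (∃ i, x = ev i) ∨ (∃ i, x = ed i) := by
    rintro (v | ⟨e, he⟩)
    · left; exact ⟨h v, by simp [ev]⟩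
    · right
      induction e using Sym2.ind with
      | _ u v =>
        have hA : G.Adj u v := he
        rw [← h.map_adj_iff, cycle_adj hl] at hA
        rcases hA with hA | hA
        · refine ⟨h u, ?_⟩
          simp [ed, ← hA]
        · refine ⟨h v, ?_⟩
          simp [ed, ← hA, Sym2.eq_swap]
  have m11 : ∀ i j, totalMatrix G (ev i) (ev j) = if i = j then 1 else 0 := by
    intro i j; simp [totalMatrix, ev]
  have m12 : ∀ i j, totalMatrix G (ev i) (ed j) = if i = j ∨ i = nxt j then 1 else 0 := by
    intro i j; simp [totalMatrix, ev, ed]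
  have m21 : ∀ i j, totalMatrix G (ed j) (ev i) = if i = j ∨ i = nxt j then 1 else 0 := by
    intro i j; simp [totalMatrix, ev, ed]
  have m22 : ∀ i j, totalMatrix G (ed i) (ed j) = if i = j then 1 else 0 := by
    intro i j
    by_cases hij : i = j
    · subst hij
      simp [totalMatrix, ed]
    · rw [if_neg hij]
      exact if_neg (fun hh => hij ((edinj i j).1 (congrArg Sum.inr hh)))
  let hf : Fin (m + 1) → Fin (l + 1) := fun a => ⟨(a : ℕ) / 2, by have := a.isLt; omega⟩
  have hfv : ∀ a, (hf a : ℕ) = (a : ℕ) / 2 := fun a => rfl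
  let φ : Fin (m + 1) → V ⊕ G.edgeSet := fun a => if (a : ℕ) % 2 = 0 then ev (hf a) else ed (hf a)
  refine ⟨φ, ⟨?_, ?_⟩, ?_⟩
  · intro a b hab
    simp only [φ] at hab
    by_cases h1 : (a : ℕ) % 2 = 0 <;> by_cases h2 : (b : ℕ) % 2 = 0
    · rw [if_pos h1, if_pos h2, evinj, Fin.ext_iff, hfv, hfv] at hab; ext; omega
    · rw [if_pos h1, if_neg h2] at hab; exact absurd hab Sum.inl_ne_inr
    · rw [if_neg h1, if_pos h2] at hab; exact absurd hab Sum.inr_ne_inl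
    · rw [if_neg h1, if_neg h2, edinj, Fin.ext_iff, hfv, hfv] at hab; ext; omega
  · intro x
    rcases surj x with ⟨i, rfl⟩ | ⟨i, rfl⟩
    · refine ⟨⟨2 * i, by have := i.isLt; omega⟩, ?_⟩
      simp [φ, hf]
    · refine ⟨⟨2 * i + 1, by have := i.isLt; omega⟩, ?_⟩
      simp only [φ, hf]
      rw [if_neg (by omega)]
      congr 1
      ext
      simp only
      omega
  · intro a b
    have ha := a.isLt
    have hb := b.isLt
    have p := prv_or a
    have q := nxt_or a
    have r := nxt_or (hf a)
    have s := nxt_or (hf b)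
    have hfa := hfv a
    have hfb := hfv b
    simp only [φ]
    by_cases h1 : (a : ℕ) % 2 = 0 <;> by_cases h2 : (b : ℕ) % 2 = 0
    · rw [if_pos h1, if_pos h2, m11]
      refine if_congr ?_ rfl rfl
      simp only [Fin.ext_iff]
      omega
    · rw [if_pos h1, if_neg h2, m12]
      refine if_congr ?_ rfl rfl
      simp only [Fin.ext_iff]
      omega
    · rw [if_neg h1, if_pos h2, m21]
      refine if_congr ?_ rfl rfl
      simp only [Fin.ext_iff]
      omega
    · rw [if_neg h1, if_neg h2, m22]
      refine if_congr ?_ rfl rfl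
      simp only [Fin.ext_iff]
      omega

end CycleDet

/-- If `G` is a cycle on `n ≥ 3` vertices, then `Δ(G) = 3` if `n ≡ 1, 2 (mod 3)` and
`Δ(G) = 2` if `n ≡ 0 (mod 3)`. -/
theorem stmt9 {V : Type*} [Fintype V] (G : SimpleGraph V) (n : ℕ) (hn : 3 ≤ n)
    (hiso : Nonempty (G ≃g SimpleGraph.cycleGraph n)) :
    maxSubdet G = if n % 3 = 0 then 2 else 3 := by
  obtain ⟨h⟩ := hiso
  obtain ⟨l, rfl⟩ : ∃ l, n = l + 1 := ⟨n - 1, by omega⟩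
  obtain ⟨m, hm⟩ : ∃ m, m + 1 = 2 * (l + 1) := ⟨2 * l + 1, by omega⟩
  obtain ⟨φ, hφ, hM⟩ := CycleDet.exists_param G (by omega) hm h
  have hgr : IsGreatest {d : ℕ | ∃ (k : ℕ) (f g : Fin k → (V ⊕ G.edgeSet)),
      Function.Injective f ∧ Function.Injective g ∧
      d = ((totalMatrix G).submatrix f g).det.natAbs} (if (l + 1) % 3 = 0 then 2 else 3) := by
    have key : ∀ (k : ℕ) (f g : Fin k → Fin (m + 1)),
        (totalMatrix G).submatrix (φ ∘ f) (φ ∘ g) = (CycleDet.circ m).submatrix f g := by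
      intro k f g
      ext a b
      simp [hM]
    constructor
    · split_ifs with h3
      · obtain ⟨k, f, g, hf, hg, hd⟩ := CycleDet.exists_two hn hm h3
        refine ⟨k, φ ∘ f, φ ∘ g, hφ.1.comp hf, hφ.1.comp hg, ?_⟩
        rw [Int.abs_eq_natAbs] at hd
        rw [key]; omega
      · refine ⟨m + 1, φ ∘ id, φ ∘ id, hφ.1.comp Function.injective_id,
          hφ.1.comp Function.injective_id, ?_⟩
        rw [key, Matrix.submatrix_id_id]
        have := CycleDet.exists_three (m := m) (by omega) (by omega)
        rw [Int.abs_eq_natAbs] at this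
        omega
    · rintro d ⟨k, f, g, hf, hg, rfl⟩
      obtain ⟨ψ, hψ⟩ := hφ.2.hasRightInverse
      have e : ∀ u : Fin k → V ⊕ G.edgeSet, u = φ ∘ (ψ ∘ u) := by
        intro u; funext i; exact (hψ (u i)).symm
      rw [e f, e g, key]
      have := CycleDet.sub_bound (m := m) (by omega) (ψ ∘ f) (ψ ∘ g) (hψ.injective.comp hg)
      rw [Int.abs_eq_natAbs] at this
      split_ifs with h3
      · have := this.2 (by omega)
        omega
      · have := this.1
        omega
  exact hgr.csSup_eq
end

section
/- Let G be a finite simple forest with at least one vertex. Then Δ(G) equals the maximum of |det L̃(G', G'')| taken over all pairs (G', G'') where G' is a subgraph of G and G'' is an induced subgraph of G'. Here, for vertices v_1, ..., v_k of G'', L̃(G', G'') is the k×k matrix A(G'') + diag(d_{G'}(v_1) − 1, ..., d_{G'}(v_k) − 1), where A(G'') is the adjacency matrix of G'' and d_{G'}(v) is the degree of v in G'. -/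
open scoped Classical

/-- The pencil `A + diag d`. -/
noncomputable def pencil {W : Type*} (A : Matrix W W ℤ) (d : W → ℤ) : Matrix W W ℤ :=
  A + Matrix.diagonal d

/-- Changing the diagonal entry of a leaf. -/
lemma det_cons_leaf {W : Type*} (A : Matrix W W ℤ) (hs : ∀ x y, A x y = A y x)
    (h0 : ∀ x, A x x = 0) (u w : W) {k : ℕ} (r c : Fin k → W)
    (hr : ∀ i, r i ≠ u) (hc : ∀ i, c i ≠ u)
    (hrw : ∀ i, A u (r i) ≠ 0 → r i = w) (hcw : ∀ i, A u (c i) ≠ 0 → c i = w) (d : W → ℤ) :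
    ((pencil A d).submatrix (Fin.cons u r : Fin (k+1) → W) (Fin.cons u c : Fin (k+1) → W)).det =
      (d u - 1) * ((pencil A d).submatrix r c).det +
      ((pencil A (d - Pi.single w (A u w * A u w))).submatrix r c).det := by
  set X := (pencil A d).submatrix (Fin.cons u r : Fin (k+1) → W) (Fin.cons u c : Fin (k+1) → W)
    with hX
  have hX00 : X 0 0 = d u := by simp [hX, pencil, h0]
  have hX0s : ∀ j : Fin k, X 0 j.succ = A u (c j) := by
    intro j; simp [hX, pencil, Matrix.diagonal_apply_ne _ (hc j).symm]
  have hXs0 : ∀ j : Fin k, X j.succ 0 = A u (r j) := by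
    intro j; simp [hX, pencil, Matrix.diagonal_apply_ne _ (hr j), hs u]
  -- the matrix with the corner replaced by one
  let Y : Matrix (Fin (k+1)) (Fin (k+1)) ℤ := fun i j => if i = 0 ∧ j = 0 then 1 else X i j
  have hXY : X.det = (d u - 1) * ((pencil A d).submatrix r c).det + Y.det := by
    rw [Matrix.det_succ_row_zero X, Matrix.det_succ_row_zero Y, Fin.sum_univ_succ,
      Fin.sum_univ_succ]
    have e1 : X.submatrix Fin.succ (Fin.succAbove 0) = (pencil A d).submatrix r c := by
      ext i j; simp [hX]
    have e2 : ∀ l : Fin (k+1), Y.submatrix Fin.succ (Fin.succAbove l) =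
        X.submatrix Fin.succ (Fin.succAbove l) := by
      intro l; ext i j
      change (if i.succ = 0 ∧ l.succAbove j = 0 then 1 else X i.succ (l.succAbove j)) =
        X i.succ (l.succAbove j)
      simp
    have e3 : ∀ j : Fin k, Y 0 j.succ = X 0 j.succ := by intro j; simp [Y]
    have e4 : Y 0 0 = 1 := by simp [Y]
    simp only [e2, e3, e4, e1, hX00]
    simp
    ring
  rw [hXY]
  congr 1
  let Z : Matrix (Fin (k+1)) (Fin (k+1)) ℤ := fun i j =>
    Y i j - (if i = 0 then 0 else Y i 0) * Y 0 j
  have hYZ : Y.det = Z.det := by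
    refine Matrix.det_eq_of_forall_row_eq_smul_add_const (fun i => if i = 0 then 0 else Y i 0) 0
      (by simp) ?_
    intro i j
    simp [Z]
  rw [hYZ, Matrix.det_succ_column_zero, Fin.sum_univ_succ]
  have z0 : Z 0 0 = 1 := by simp [Z, Y]
  have zs : ∀ i : Fin k, Z i.succ 0 = 0 := by intro i; simp [Z, Y]
  have e1 : Z.submatrix (Fin.succAbove 0) Fin.succ =
      (pencil A (d - Pi.single w (A u w * A u w))).submatrix r c := by
    ext i j
    have hx : X i.succ j.succ = pencil A d (r i) (c j) := by simp [hX]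
    have hz : Z i.succ j.succ = pencil A d (r i) (c j) - A u (r i) * A u (c j) := by
      simp [Z, Y, hx, hXs0, hX0s]
    simp only [Matrix.submatrix_apply, Fin.succAbove_zero, hz]
    by_cases h1 : A u (r i) = 0
    · have : pencil A (d - Pi.single w (A u w * A u w)) (r i) (c j) = pencil A d (r i) (c j) := by
        simp only [pencil, Matrix.add_apply, Matrix.diagonal_apply, Pi.sub_apply, Pi.single_apply]
        split_ifs <;> simp_all
      simp [h1, this]
    by_cases h2 : A u (c j) = 0
    · have : pencil A (d - Pi.single w (A u w * A u w)) (r i) (c j) = pencil A d (r i) (c j) := by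
        simp only [pencil, Matrix.add_apply, Matrix.diagonal_apply, Pi.sub_apply, Pi.single_apply]
        split_ifs <;> simp_all
      simp [h2, this]
    rw [hrw i h1, hcw j h2]
    simp [pencil]
    ring
  rw [e1]
  simp [z0, zs]

/-- A row with a single possibly nonzero entry in front. -/
lemma det_cons_pendant {W : Type*} (M : Matrix W W ℤ) (u w : W) {k : ℕ} (r c : Fin k → W)
    (h : ∀ j, M u (c j) = 0) :
    (M.submatrix (Fin.cons u r : Fin (k+1) → W) (Fin.cons w c : Fin (k+1) → W)).det =
      M u w * (M.submatrix r c).det := by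
  rw [Matrix.det_succ_row_zero, Fin.sum_univ_succ]
  have e : (M.submatrix (Fin.cons u r : Fin (k+1) → W) (Fin.cons w c : Fin (k+1) → W)).submatrix
      Fin.succ (Fin.succAbove 0) = M.submatrix r c := by
    ext i j; simp
  rw [e]
  simp [h]

/-- The minor with rows `r` and columns `c` reduces to a principal minor, uniformly in `d`. -/
def Reduces {W : Type*} (A : Matrix W W ℤ) {k : ℕ} (r c : Fin k → W) : Prop :=
  ∃ (m : ℕ) (z : Fin m → W) (ε : ℤ), Function.Injective z ∧ ε.natAbs ≤ 1 ∧
    (∀ i, z i ∈ Set.range r ∧ z i ∈ Set.range c) ∧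
    ∀ d, ((pencil A d).submatrix r c).det = ε * ((pencil A d).submatrix z z).det

lemma Reduces.symm {W : Type*} {A : Matrix W W ℤ} (hs : ∀ x y, A x y = A y x)
    {k : ℕ} {r c : Fin k → W} (h : Reduces A r c) : Reduces A c r := by
  obtain ⟨m, z, ε, hz, hε, hm, hd⟩ := h
  refine ⟨m, z, ε, hz, hε, fun i => (hm i).symm, fun d => ?_⟩
  rw [← hd d, ← Matrix.det_transpose]
  congr 1
  ext i j
  simp only [pencil, Matrix.transpose_apply, Matrix.submatrix_apply, Matrix.add_apply,
    Matrix.diagonal_apply, hs (c j)]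
  congr 1
  by_cases h : r i = c j
  · simp [h]
  · simp [h, Ne.symm h]

lemma Reduces.of_perm {W : Type*} {A : Matrix W W ℤ} {k : ℕ} {r c : Fin k → W}
    (σ : Equiv.Perm (Fin k)) (h : Reduces A (r ∘ σ) c) : Reduces A r c := by
  obtain ⟨m, z, ε, hz, hε, hm, hd⟩ := h
  refine ⟨m, z, (Equiv.Perm.sign σ : ℤ) * ε, hz, ?_, fun i => ⟨?_, (hm i).2⟩, fun d => ?_⟩
  · rw [Int.natAbs_mul]; simpa using hε
  · have := (hm i).1
    rwa [σ.surjective.range_comp] at this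
  · rw [mul_assoc, ← hd d]
    have := Matrix.det_permute σ ((pencil A d).submatrix r c)
    have e : ((pencil A d).submatrix r c).submatrix σ id =
      (pencil A d).submatrix (r ∘ σ) c := rfl
    rw [e] at this
    rw [this, ← mul_assoc]
    have : ((Equiv.Perm.sign σ : ℤ)) * ((Equiv.Perm.sign σ : ℤˣ) : ℤ) = 1 := by
      rw [← Units.val_mul]; simp
    push_cast at this ⊢
    simp [this]

lemma exists_cons {W : Type*} {k : ℕ} (r : Fin (k+1) → W) (hr : Function.Injective r) (u : W)
    (hu : u ∈ Set.range r) : ∃ (σ : Equiv.Perm (Fin (k+1))) (r' : Fin k → W),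
      r ∘ σ = Fin.cons u r' ∧ Function.Injective r' ∧ (∀ i, r' i ≠ u) := by
  obtain ⟨i, hi⟩ := hu
  have e : r ∘ (Equiv.swap 0 i) = (Fin.cons u (Fin.tail (r ∘ (Equiv.swap 0 i))) :
      Fin (k+1) → W) := by
    conv_lhs => rw [← Fin.cons_self_tail (r ∘ (Equiv.swap 0 i))]
    simp [hi]
  have hinj : Function.Injective (r ∘ (Equiv.swap 0 i)) := hr.comp (Equiv.injective _)
  refine ⟨Equiv.swap 0 i, Fin.tail (r ∘ (Equiv.swap 0 i)), e, ?_, ?_⟩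
  · exact hinj.comp (Fin.succ_injective _)
  · intro j hj
    have h1 : (r ∘ (Equiv.swap 0 i)) j.succ = (r ∘ (Equiv.swap 0 i)) 0 := by
      rw [show (r ∘ (Equiv.swap 0 i)) 0 = u by simp [hi]]
      exact hj
    exact Fin.succ_ne_zero j (hinj h1)

lemma reduces_all {W : Type*} (A : Matrix W W ℤ) (hs : ∀ x y, A x y = A y x)
    (h0 : ∀ x, A x x = 0) (h01 : ∀ x y, (A x y).natAbs ≤ 1)
    (hleaf : ∀ N : Set W, N.Nonempty → ∃ u ∈ N, ∃ w, ∀ v ∈ N, A u v ≠ 0 → v = w) :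
    ∀ (k : ℕ) (r c : Fin k → W), Function.Injective r → Function.Injective c →
      Reduces A r c := by
  intro k
  induction k with
  | zero =>
    intro r c _ _
    refine ⟨0, r, 1, fun i => i.elim0, by simp, fun i => i.elim0, fun d => ?_⟩
    simp
  | succ k ih =>
    -- the case where the leaf is a row but not a column
    have caseA : ∀ (r c : Fin (k+1) → W), Function.Injective r → Function.Injective c →
        ∀ u w, u ∈ Set.range r → u ∉ Set.range c → (∀ j, A u (c j) ≠ 0 → c j = w) →
        Reduces A r c := by
      intro r c hr hc u w hur huc hw
      obtain ⟨σ, r', e, hr', hru⟩ := exists_cons r hr u hur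
      apply Reduces.of_perm σ
      by_cases hwc : w ∈ Set.range c
      · obtain ⟨τ, c', e', hc', hcw⟩ := exists_cons c hc w hwc
        apply Reduces.symm hs
        apply Reduces.of_perm τ
        apply Reduces.symm hs
        have hcr : Set.range c = insert w (Set.range c') := by
          rw [← Fin.range_cons, ← e', τ.surjective.range_comp]
        obtain ⟨m, z, ε, hz, hε, hm, hd⟩ := ih r' c' hr' hc'
        refine ⟨m, z, A u w * ε, hz, ?_, ?_, ?_⟩
        · rw [Int.natAbs_mul]; exact Nat.mul_le_mul (h01 u w) hε
        · intro i
          rw [e, e', Fin.range_cons, Fin.range_cons]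
          exact ⟨Or.inr (hm i).1, Or.inr (hm i).2⟩
        · intro d
          rw [e, e']
          have huw : u ≠ w := by rintro rfl; exact huc hwc
          have key : ∀ j, u ≠ c' j := by
            intro j h
            apply huc
            rw [hcr, h]
            exact Or.inr ⟨j, rfl⟩
          rw [det_cons_pendant, hd d]
          · simp [pencil, Matrix.diagonal_apply_ne _ huw, mul_assoc]
          · intro j
            simp only [pencil, Matrix.add_apply, Matrix.diagonal_apply_ne _ (key j), add_zero]
            by_contra hne
            have : c' j ∈ Set.range c := by rw [hcr]; exact Or.inr ⟨j, rfl⟩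
            obtain ⟨l, hl⟩ := this
            rw [← hl] at hne
            exact hcw j (by rw [← hl]; exact hw l hne)
      · refine ⟨0, Fin.elim0, 0, fun i => i.elim0, by simp, fun i => i.elim0, fun d => ?_⟩
        rw [zero_mul]
        apply Matrix.det_eq_zero_of_row_eq_zero (0 : Fin (k+1))
        intro j
        have huj : u ≠ c j := by rintro rfl; exact huc ⟨j, rfl⟩
        rw [e]
        simp only [Matrix.submatrix_apply, Fin.cons_zero, pencil, Matrix.add_apply,
          Matrix.diagonal_apply_ne _ huj, add_zero]
        by_contra hne
        exact hwc ⟨j, hw j hne⟩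
    intro r c hr hc
    obtain ⟨u, huN, w, hw⟩ := hleaf (Set.range r ∪ Set.range c) ⟨r 0, Or.inl ⟨0, rfl⟩⟩
    by_cases hur : u ∈ Set.range r
    · by_cases huc : u ∈ Set.range c
      · obtain ⟨σ, r', e, hr', hru⟩ := exists_cons r hr u hur
        obtain ⟨τ, c', e', hc', hcu⟩ := exists_cons c hc u huc
        have hrr : Set.range r = insert u (Set.range r') := by
          rw [← Fin.range_cons, ← e, σ.surjective.range_comp]
        have hcr : Set.range c = insert u (Set.range c') := by
          rw [← Fin.range_cons, ← e', τ.surjective.range_comp]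
        apply Reduces.of_perm σ
        apply Reduces.symm hs
        apply Reduces.of_perm τ
        apply Reduces.symm hs
        obtain ⟨m, z, ε, hz, hε, hm, hd⟩ := ih r' c' hr' hc'
        have hzu : ∀ i, z i ≠ u := by
          intro i h
          obtain ⟨l, hl⟩ := (hm i).1
          exact hru l (hl.trans h)
        have hr'w : ∀ i, A u (r' i) ≠ 0 → r' i = w := fun i =>
          hw _ (Or.inl (by rw [hrr]; exact Or.inr ⟨i, rfl⟩))
        have hc'w : ∀ i, A u (c' i) ≠ 0 → c' i = w := fun i =>
          hw _ (Or.inr (by rw [hcr]; exact Or.inr ⟨i, rfl⟩))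
        have hzw : ∀ i, A u (z i) ≠ 0 → z i = w := by
          intro i
          obtain ⟨l, hl⟩ := (hm i).1
          rw [← hl]
          exact hr'w l
        refine ⟨m + 1, Fin.cons u z, ε, ?_, hε, ?_, ?_⟩
        · rw [Fin.cons_injective_iff]
          exact ⟨fun ⟨i, hi⟩ => hzu i hi, hz⟩
        · intro i
          rw [e, e', Fin.range_cons, Fin.range_cons]
          refine Fin.cases ?_ (fun i => ?_) i
          · exact ⟨Or.inl rfl, Or.inl rfl⟩
          · exact ⟨Or.inr (hm i).1, Or.inr (hm i).2⟩
        · intro d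
          rw [e, e', det_cons_leaf A hs h0 u w r' c' hru hcu hr'w hc'w,
            det_cons_leaf A hs h0 u w z z hzu hzu hzw hzw, hd, hd]
          ring
      · exact caseA r c hr hc u w hur huc (fun j => hw _ (Or.inr ⟨j, rfl⟩))
    · have huc : u ∈ Set.range c := huN.resolve_left hur
      exact (caseA c r hc hr u w huc hur (fun j => hw _ (Or.inl ⟨j, rfl⟩))).symm hs

lemma exists_leaf_univ {U : Type*} [Finite U] [Nonempty U] (H : SimpleGraph U)
    (hH : H.IsAcyclic) : ∃ v w, ∀ x, H.Adj v x → x = w := by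
  have := Fintype.ofFinite U
  rcases subsingleton_or_nontrivial U with h | h
  · obtain ⟨v⟩ := ‹Nonempty U›
    exact ⟨v, v, fun x _ => Subsingleton.elim _ _⟩
  · obtain ⟨T, hT0, -, hT2⟩ := SimpleGraph.Connected.exists_isTree_le_of_le_of_isAcyclic
      (G := (⊤ : SimpleGraph U)) (H := H) SimpleGraph.connected_top le_top hH
    obtain ⟨v, hv⟩ := hT2.exists_vert_degree_one_of_nontrivial
    obtain ⟨w, -, hw⟩ := SimpleGraph.degree_eq_one_iff_existsUnique_adj.mp hv
    exact ⟨v, w, fun x hx => hw x (hT0 hx)⟩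

lemma exists_leaf {V : Type*} [Finite V] (H : SimpleGraph V)
    (hH : H.IsAcyclic) (S : Set V) (hS : S.Nonempty) :
    ∃ v ∈ S, ∃ w, ∀ x ∈ S, H.Adj v x → x = w := by
  have : Nonempty S := hS.to_subtype
  obtain ⟨v, w, h⟩ := exists_leaf_univ (H.induce S) (hH.induce S)
  exact ⟨v, v.2, w, fun x hx hvx => congrArg Subtype.val (h ⟨x, hx⟩ hvx)⟩

lemma totalMatrix_leaf {V : Type*} [Finite V] (G : SimpleGraph V) (hG : G.IsAcyclic)
    (N : Set (V ⊕ G.edgeSet)) (hN : N.Nonempty) :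
    ∃ u ∈ N, ∃ w, ∀ v ∈ N, (totalMatrix G - 1) u v ≠ 0 → v = w := by
  have hVV : ∀ a b : V, (totalMatrix G - 1) (Sum.inl a) (Sum.inl b) = 0 := by
    intro a b; simp [totalMatrix, Matrix.one_apply]
  have hEE : ∀ a b : G.edgeSet, (totalMatrix G - 1) (Sum.inr a) (Sum.inr b) = 0 := by
    intro a b; simp [totalMatrix, Matrix.one_apply]
  have hVE : ∀ (a : V) (b : G.edgeSet), (totalMatrix G - 1) (Sum.inl a) (Sum.inr b) ≠ 0 →
      a ∈ (b : Sym2 V) := by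
    intro a b; simp [totalMatrix]
  have hEV : ∀ (a : V) (b : G.edgeSet), (totalMatrix G - 1) (Sum.inr b) (Sum.inl a) ≠ 0 →
      a ∈ (b : Sym2 V) := by
    intro a b; simp [totalMatrix]
  by_cases hbad : ∃ e : G.edgeSet, Sum.inr e ∈ N ∧ ∃ a ∈ (e : Sym2 V), Sum.inl a ∉ N
  · obtain ⟨e, heN, a, hae, haN⟩ := hbad
    refine ⟨Sum.inr e, heN, Sum.inl (Sym2.Mem.other hae), ?_⟩
    rintro (v | f) hv hne
    · have hve := hEV _ _ hne
      have : v ≠ a := by rintro rfl; exact haN hv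
      rw [← Sym2.other_spec hae, Sym2.mem_iff] at hve
      rw [hve.resolve_left this]
    · exact absurd (hEE _ _) hne
  · push Not at hbad
    have hSne : {v : V | (Sum.inl v : V ⊕ G.edgeSet) ∈ N}.Nonempty := by
      obtain ⟨x, hx⟩ := hN
      rcases x with v | e
      · exact ⟨v, hx⟩
      · obtain ⟨e, he⟩ := e
        induction e with | _ a b =>
        exact ⟨a, hbad _ hx a (Sym2.mem_mk_left a b)⟩
    have hH : (SimpleGraph.fromEdgeSet
        {e : Sym2 V | ∃ h : e ∈ G.edgeSet, Sum.inr ⟨e, h⟩ ∈ N}).IsAcyclic := by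
      refine hG.anti ?_
      intro a b hab
      rw [SimpleGraph.fromEdgeSet_adj] at hab
      obtain ⟨⟨h, -⟩, -⟩ := hab
      exact h
    obtain ⟨v, hv, w, hw⟩ := exists_leaf _ hH _ hSne
    by_cases hvw : s(v, w) ∈ G.edgeSet
    · refine ⟨Sum.inl v, hv, Sum.inr ⟨s(v, w), hvw⟩, ?_⟩
      rintro (x | f) hx hne
      · exact absurd (hVV _ _) hne
      · have hvf := hVE _ _ hne
        obtain ⟨f, hf⟩ := f
        have h1 : s(v, Sym2.Mem.other hvf) = f := Sym2.other_spec hvf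
        have h2 : Sym2.Mem.other hvf = w := by
          apply hw
          · exact hbad _ hx _ (Sym2.other_mem hvf)
          · rw [SimpleGraph.fromEdgeSet_adj]
            have h3 : s(v, Sym2.Mem.other hvf) ∈ G.edgeSet := by rw [h1]; exact hf
            refine ⟨⟨h3, ?_⟩, G.ne_of_adj h3⟩
            simp only [h1]
            exact hx
        rw [h2] at h1
        subst h1
        rfl
    · refine ⟨Sum.inl v, hv, Sum.inl v, ?_⟩
      rintro (x | f) hx hne
      · exact absurd (hVV _ _) hne
      · exfalso
        have hvf := hVE _ _ hne
        obtain ⟨f, hf⟩ := f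
        have h1 : s(v, Sym2.Mem.other hvf) = f := Sym2.other_spec hvf
        have h3 : s(v, Sym2.Mem.other hvf) ∈ G.edgeSet := by rw [h1]; exact hf
        have h2 : Sym2.Mem.other hvf = w := by
          apply hw
          · exact hbad _ hx _ (Sym2.other_mem hvf)
          · rw [SimpleGraph.fromEdgeSet_adj]
            refine ⟨⟨h3, ?_⟩, G.ne_of_adj h3⟩
            simp only [h1]
            exact hx
        rw [h2] at h3
        exact hvw h3

/-- The matrix `L̃`. -/
noncomputable def Ltilde {V : Type*} [Fintype V] (G' : SimpleGraph V) (S : Finset V) :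
    Matrix S S ℤ :=
  Matrix.of fun a b : S =>
          (if G'.Adj (a : V) (b : V) then (1 : ℤ) else 0) +
          (if a = b then (G'.degree (a : V) : ℤ) - 1 else 0)

/-- Principal minors of the total matrix. -/
lemma principal_minor {V : Type*} [Fintype V] (G G' : SimpleGraph V) (S : Finset V)
    (F : Finset G.edgeSet) (hF : ∀ e : Sym2 V, e ∈ G'.edgeSet ↔ ∃ f ∈ F, (f : Sym2 V) = e) :
    ((totalMatrix G).submatrix (Sum.map (Subtype.val : S → V) (Subtype.val : F → G.edgeSet))
      (Sum.map (Subtype.val : S → V) (Subtype.val : F → G.edgeSet))).det.natAbs =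
    (Ltilde G' S).det.natAbs := by
  let B : Matrix S F ℤ := fun a e => if (a : V) ∈ ((e : G.edgeSet) : Sym2 V) then 1 else 0
  have hblk : (totalMatrix G).submatrix
      (Sum.map (Subtype.val : S → V) (Subtype.val : F → G.edgeSet))
      (Sum.map (Subtype.val : S → V) (Subtype.val : F → G.edgeSet)) =
      Matrix.fromBlocks 1 B B.transpose 1 := by
    ext (a | e) (b | f)
    · simp [totalMatrix, Matrix.one_apply]
    · rw [Matrix.fromBlocks_apply₁₂]; rfl
    · rw [Matrix.fromBlocks_apply₂₁]; rfl
    · simp [totalMatrix, Matrix.one_apply]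
  rw [hblk, Matrix.det_fromBlocks_one₂₂]
  have hL : (1 - B * B.transpose) = - Ltilde G' S := by
    ext a b
    have hsum : (B * B.transpose) a b =
        (G'.incMatrix ℤ * (G'.incMatrix ℤ).transpose) (a : V) (b : V) := by
      rw [Matrix.mul_apply, Matrix.mul_apply]
      refine Finset.sum_of_injOn (fun f : F => ((f : G.edgeSet) : Sym2 V)) ?_ ?_ ?_ ?_
      · intro x _ y _ h
        exact Subtype.ext (Subtype.ext h)
      · intro x _; simp
      · intro e _ he
        have : e ∉ G'.edgeSet := by
          rw [hF]
          rintro ⟨f, hf, rfl⟩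
          exact he ⟨⟨f, hf⟩, by simp, rfl⟩
        rw [SimpleGraph.incMatrix_of_notMem_incidenceSet, zero_mul]
        exact fun h => this h.1
      · intro f _
        have : ((f : G.edgeSet) : Sym2 V) ∈ G'.edgeSet := (hF _).2 ⟨f, f.2, rfl⟩
        rw [Matrix.transpose_apply, Matrix.transpose_apply]
        simp only [B, SimpleGraph.incMatrix_apply',
          SimpleGraph.incidenceSet, Set.mem_ofPred_eq, this, true_and]
    rw [Matrix.sub_apply, hsum, SimpleGraph.incMatrix_mul_transpose]
    by_cases hab : a = b
    · subst hab
      simp [Ltilde]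
    · have hab' : (a : V) ≠ b := fun h => hab (Subtype.ext h)
      simp [Ltilde, hab, hab']
  rw [hL, Matrix.det_neg, Int.natAbs_mul]
  simp [Int.natAbs_pow]

/-- For a finite simple forest `G` (with at least one vertex), `Δ(G)` equals the maximum of
`|det L̃(G', G'')|` over all pairs where `G' ⊆ G` is a subgraph and `G''` is the induced
subgraph of `G'` on a vertex set `S`; here `L̃(G', G'') = A(G'') + diag(d_{G'}(v) - 1)_{v ∈ S}`. -/
theorem stmt14 {V : Type*} [Fintype V] [Nonempty V] (G : SimpleGraph V)
    (hG : G.IsAcyclic) :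
    maxSubdet G = sSup {d : ℕ |
      ∃ G' : SimpleGraph V, G' ≤ G ∧ ∃ S : Finset V,
        d = (Matrix.det (Matrix.of fun a b : S =>
          (if G'.Adj (a : V) (b : V) then (1 : ℤ) else 0) +
          (if a = b then (G'.degree (a : V) : ℤ) - 1 else 0))).natAbs} := by
  change _ = sSup {d : ℕ | ∃ G' : SimpleGraph V, G' ≤ G ∧ ∃ S : Finset V,
        d = (Ltilde G' S).det.natAbs}
  set Q : Set ℕ := {d : ℕ | ∃ G' : SimpleGraph V, G' ≤ G ∧ ∃ S : Finset V,
        d = (Ltilde G' S).det.natAbs} with hQ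
  have hQbdd : BddAbove Q := by
    apply Set.Finite.bddAbove
    refine (Set.finite_range (fun p : SimpleGraph V × Finset V =>
      (Ltilde p.1 p.2).det.natAbs)).subset ?_
    rintro d ⟨G', -, S, rfl⟩
    exact ⟨(G', S), rfl⟩
  have hQne : Q.Nonempty := ⟨_, ⊥, bot_le, ∅, rfl⟩
  unfold maxSubdet
  set P : Set ℕ := {d : ℕ | ∃ (k : ℕ) (f g : Fin k → (V ⊕ G.edgeSet)),
    Function.Injective f ∧ Function.Injective g ∧
    d = ((totalMatrix G).submatrix f g).det.natAbs} with hP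
  have hQP : Q ⊆ P := by
    rintro d ⟨G', hle, S, rfl⟩
    let F : Finset G.edgeSet := Finset.univ.filter (fun e => (e : Sym2 V) ∈ G'.edgeSet)
    have hF : ∀ e : Sym2 V, e ∈ G'.edgeSet ↔ ∃ f ∈ F, (f : Sym2 V) = e := by
      intro e
      constructor
      · intro he
        exact ⟨⟨e, SimpleGraph.edgeSet_mono hle he⟩, by simp [F, he], rfl⟩
      · rintro ⟨f, hf, rfl⟩
        simpa [F] using hf
    have hinj : Function.Injective
        (Sum.map (Subtype.val : S → V) (Subtype.val : F → G.edgeSet)) :=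
      Subtype.val_injective.sumMap Subtype.val_injective
    let e := (Fintype.equivFin (S ⊕ F)).symm
    refine ⟨_, (Sum.map (Subtype.val : S → V) (Subtype.val : F → G.edgeSet)) ∘ e,
      (Sum.map (Subtype.val : S → V) (Subtype.val : F → G.edgeSet)) ∘ e,
      hinj.comp e.injective, hinj.comp e.injective, ?_⟩
    rw [← principal_minor G G' S F hF, ← Matrix.submatrix_submatrix,
      Matrix.det_submatrix_equiv_self]
  have hPQ : ∀ d ∈ P, ∃ q ∈ Q, d ≤ q := by
    rintro d ⟨k, f, g, hf, hg, rfl⟩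
    have hsym : ∀ x y, (totalMatrix G - 1) x y = (totalMatrix G - 1) y x := by
      rintro (a | a) (b | b) <;> simp [totalMatrix, Matrix.one_apply]
    have h01 : ∀ x y, ((totalMatrix G - 1) x y).natAbs ≤ 1 := by
      rintro (a | a) (b | b) <;> simp [totalMatrix, Matrix.one_apply] <;> split_ifs <;> simp
    have h0 : ∀ x, (totalMatrix G - 1) x x = 0 := by
      rintro (a | a) <;> simp [totalMatrix]
    obtain ⟨m, z, ε, hz, hε, -, hd⟩ := reduces_all (totalMatrix G - 1) hsym h0 h01
      (totalMatrix_leaf G hG) k f g hf hg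
    have hpen : pencil (totalMatrix G - 1) (fun _ => 1) = totalMatrix G := by
      ext x y; simp [pencil, Matrix.one_apply, Matrix.diagonal_apply]
      split_ifs <;> simp
    have hd1 := hd (fun _ => 1)
    rw [hpen] at hd1
    let S : Finset V := Finset.univ.filter (fun v => Sum.inl v ∈ Set.range z)
    let F : Finset G.edgeSet := Finset.univ.filter (fun e => Sum.inr e ∈ Set.range z)
    let G' : SimpleGraph V := SimpleGraph.fromEdgeSet {e | ∃ f ∈ F, (f : Sym2 V) = e}
    have hF : ∀ e : Sym2 V, e ∈ G'.edgeSet ↔ ∃ f ∈ F, (f : Sym2 V) = e := by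
      intro e
      simp only [G', SimpleGraph.edgeSet_fromEdgeSet]
      constructor
      · exact fun h => h.1
      · rintro ⟨f, hf, rfl⟩
        exact ⟨⟨f, hf, rfl⟩, G.not_isDiag_of_mem_edgeSet f.2⟩
    have hle : G' ≤ G := by
      rw [← SimpleGraph.edgeSet_subset_edgeSet]
      intro e he
      obtain ⟨f, -, rfl⟩ := (hF e).1 he
      exact f.2
    refine ⟨_, ⟨G', hle, S, rfl⟩, ?_⟩
    rw [← principal_minor G G' S F hF, hd1, Int.natAbs_mul]
    have hinj : Function.Injective
        (Sum.map (Subtype.val : S → V) (Subtype.val : F → G.edgeSet)) :=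
      Subtype.val_injective.sumMap Subtype.val_injective
    have hrange : Set.range z =
        Set.range (Sum.map (Subtype.val : S → V) (Subtype.val : F → G.edgeSet)) := by
      ext (v | e) <;> simp [S, F]
    let e : Fin m ≃ (S ⊕ F) := ((Equiv.ofInjective z hz).trans (Equiv.setCongr hrange)).trans
      (Equiv.ofInjective _ hinj).symm
    have he : z = (Sum.map (Subtype.val : S → V) (Subtype.val : F → G.edgeSet)) ∘ e := by
      funext i
      simp only [e, Function.comp, Equiv.trans_apply]
      rw [Equiv.apply_ofInjective_symm hinj]
      rfl
    have hdet : ((totalMatrix G).submatrix z z).det = ((totalMatrix G).submatrix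
        (Sum.map (Subtype.val : S → V) (Subtype.val : F → G.edgeSet))
        (Sum.map (Subtype.val : S → V) (Subtype.val : F → G.edgeSet))).det := by
      rw [he, ← Matrix.submatrix_submatrix, Matrix.det_submatrix_equiv_self]
    rw [hdet]
    exact (Nat.mul_le_mul_right _ hε).trans (by simp)
  have hPbdd : BddAbove P := by
    obtain ⟨b, hb⟩ := hQbdd
    refine ⟨b, fun d hd => ?_⟩
    obtain ⟨q, hq, hdq⟩ := hPQ d hd
    exact hdq.trans (hb hq)
  apply le_antisymm
  · refine csSup_le (hQne.mono hQP) fun d hd => ?_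
    obtain ⟨q, hq, hdq⟩ := hPQ d hd
    exact hdq.trans (le_csSup hQbdd hq)
  · exact csSup_le_csSup hPbdd hQne hQP
end

section
/- Let G be a finite simple forest, let d_1 ≥ d_2 ≥ ⋯ ≥ d_n be the degrees of the vertices of G in nonincreasing order, and let n_2 be the number of vertices of G of degree at least 2. Then Δ(G) ≥ √( ∏_{i=1}^{n_2} (d_i − 1) ). -/
open scoped Classical

/-- The set of subdeterminants is bounded. -/
lemma subdet_bddAbove {V : Type*} [Fintype V] (G : SimpleGraph V) :
    BddAbove {d : ℕ | ∃ (k : ℕ) (f g : Fin k → (V ⊕ G.edgeSet)),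
      Function.Injective f ∧ Function.Injective g ∧
      d = ((totalMatrix G).submatrix f g).det.natAbs} := by
  apply Set.Finite.bddAbove
  have hfin : (⋃ k ∈ Set.Iic (Fintype.card (V ⊕ G.edgeSet)),
      Set.range (fun p : (Fin k → (V ⊕ G.edgeSet)) × (Fin k → (V ⊕ G.edgeSet)) =>
        ((totalMatrix G).submatrix p.1 p.2).det.natAbs)).Finite :=
    Set.Finite.biUnion (Set.finite_Iic _) (fun k _ => Set.finite_range _)
  refine hfin.subset ?_
  rintro d ⟨k, f, g, hf, _, rfl⟩
  have hk : k ≤ Fintype.card (V ⊕ G.edgeSet) := by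
    simpa using Fintype.card_le_of_injective f hf
  exact Set.mem_biUnion (Set.mem_Iic.2 hk) ⟨(f, g), rfl⟩

/-- Any injectively indexed principal submatrix gives a lower bound. -/
lemma le_maxSubdet {V : Type*} [Fintype V] (G : SimpleGraph V) {ι : Type*} [Fintype ι]
    (h : ι → V ⊕ G.edgeSet) (hh : Function.Injective h) :
    ((totalMatrix G).submatrix h h).det.natAbs ≤ maxSubdet G := by
  apply le_csSup (subdet_bddAbove G)
  let e := (Fintype.equivFin ι).symm
  refine ⟨Fintype.card ι, h ∘ e, h ∘ e, hh.comp e.injective, hh.comp e.injective, ?_⟩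
  rw [← Matrix.submatrix_submatrix, Matrix.det_submatrix_equiv_self]

/-- Row sums of the incidence matrix are degrees. -/
lemma sum_inc {V : Type*} [Fintype V] (G : SimpleGraph V) [DecidableRel G.Adj] (v : V) :
    (∑ e : G.edgeSet, if v ∈ (e : Sym2 V) then (1 : ℤ) else 0) = G.degree v := by
  rw [Finset.sum_boole, ← G.card_incidenceFinset_eq_degree v]
  congr 1
  refine Finset.card_bij (fun e _ => (e : Sym2 V)) ?_ ?_ ?_
  · intro e he
    simp only [Finset.mem_filter, Finset.mem_univ, true_and] at he
    rw [SimpleGraph.mem_incidenceFinset]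
    exact ⟨e.2, he⟩
  · intro a _ b _ hab
    exact Subtype.ext hab
  · intro b hb
    rw [SimpleGraph.mem_incidenceFinset] at hb
    exact ⟨⟨b, hb.1⟩, by simpa using hb.2, rfl⟩

/-- An independent set of vertices together with all edges. -/
lemma indep_bound {V : Type*} [Fintype V] (G : SimpleGraph V) [DecidableRel G.Adj]
    (S : Finset V) (hS : ∀ v ∈ S, ∀ w ∈ S, ¬ G.Adj v w) (h2 : ∀ v ∈ S, 2 ≤ G.degree v) :
    ∏ v ∈ S, ((G.degree v : ℝ) - 1) ≤ (maxSubdet G : ℝ) := by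
  let h : S ⊕ G.edgeSet → V ⊕ G.edgeSet := Sum.map Subtype.val id
  have hh : Function.Injective h := Subtype.val_injective.sumMap Function.injective_id
  let B : Matrix S G.edgeSet ℤ := fun v e => if (v : V) ∈ (e : Sym2 V) then 1 else 0
  have hM : (totalMatrix G).submatrix h h = Matrix.fromBlocks 1 B B.transpose 1 := by
    ext a b
    rcases a with a | a <;> rcases b with b | b
    · change (if (a : V) = (b : V) then (1 : ℤ) else 0) = (1 : Matrix S S ℤ) a b
      by_cases hab : a = b
      · subst hab
        rw [Matrix.one_apply_eq, if_pos rfl]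
      · rw [Matrix.one_apply_ne hab, if_neg (fun hc => hab (Subtype.ext hc))]
    · rfl
    · rfl
    · change (if a = b then (1 : ℤ) else 0) = (1 : Matrix G.edgeSet G.edgeSet ℤ) a b
      by_cases hab : a = b
      · subst hab
        rw [Matrix.one_apply_eq, if_pos rfl]
      · rw [Matrix.one_apply_ne hab, if_neg hab]
  have hD : (1 : Matrix S S ℤ) - B * B.transpose =
      Matrix.diagonal (fun v : S => 1 - (G.degree (v : V) : ℤ)) := by
    ext v w
    rw [Matrix.sub_apply, Matrix.mul_apply]
    by_cases hvw : v = w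
    · subst hvw
      simp only [Matrix.one_apply_eq, Matrix.diagonal_apply_eq, Matrix.transpose_apply]
      rw [← sum_inc G v]
      congr 1
      apply Finset.sum_congr rfl
      intro e _
      simp [B]
    · rw [Matrix.one_apply_ne hvw, Matrix.diagonal_apply_ne _ hvw, Finset.sum_eq_zero, sub_zero]
      intro e _
      change (if (v : V) ∈ (e : Sym2 V) then (1 : ℤ) else 0) *
        (if (w : V) ∈ (e : Sym2 V) then (1 : ℤ) else 0) = 0
      by_cases h1 : (v : V) ∈ (e : Sym2 V)
      · by_cases h3 : (w : V) ∈ (e : Sym2 V)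
        · exfalso
          have hne : (v : V) ≠ w := fun hc => hvw (Subtype.ext hc)
          have := (Sym2.mem_and_mem_iff hne).1 ⟨h1, h3⟩
          have he := e.2
          rw [this] at he
          exact hS v v.2 w w.2 he
        · simp [h3]
      · simp [h1]
  have hb := le_maxSubdet G h hh
  have hdet : (Matrix.fromBlocks 1 B B.transpose 1).det =
      ∏ v : S, (1 - (G.degree (v : V) : ℤ)) := by
    rw [← Matrix.det_diagonal, ← hD]
    convert Matrix.det_fromBlocks_one₂₂ (1 : Matrix S S ℤ) B B.transpose
  have hb0 : (∏ v : S, (1 - (G.degree (v : V) : ℤ))).natAbs ≤ maxSubdet G := by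
    rw [← hdet, ← hM]
    convert hb
  have hb' : (((∏ v : S, (1 - (G.degree (v : V) : ℤ))).natAbs : ℕ) : ℝ) ≤ (maxSubdet G : ℝ) := by
    exact_mod_cast hb0
  refine le_trans (le_of_eq ?_) hb'
  rw [Nat.cast_natAbs, Finset.abs_prod, ← Finset.prod_coe_sort S]
  push_cast
  apply Finset.prod_congr rfl
  intro v _
  have : (2 : ℝ) ≤ G.degree (v : V) := by exact_mod_cast h2 v v.2
  rw [abs_of_nonpos (by linarith)]
  ring

/-- For a finite simple forest `G` with degree sequence `d₁ ≥ ⋯ ≥ dₙ` and `n₂` vertices of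
degree at least `2`: `Δ(G) ≥ √(∏_{i=1}^{n₂} (dᵢ - 1))`, the product being over the degrees
of the vertices of degree at least `2`. -/
theorem stmt15 {V : Type*} [Fintype V] (G : SimpleGraph V) [DecidableRel G.Adj]
    (hG : G.IsAcyclic) :
    Real.sqrt (∏ v ∈ Finset.univ.filter (fun v => 2 ≤ G.degree v),
      ((G.degree v : ℝ) - 1)) ≤ (maxSubdet G : ℝ) := by
  obtain ⟨c⟩ := hG.colorable_two
  set T := Finset.univ.filter (fun v => 2 ≤ G.degree v) with hT
  have h2 : ∀ v ∈ T, 2 ≤ G.degree v := fun v hv => (Finset.mem_filter.1 hv).2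
  have b0 := indep_bound G (T.filter (fun v => c v = 0))
    (by
      intro v hv w hw hadj
      exact c.valid hadj ((Finset.mem_filter.1 hv).2.trans (Finset.mem_filter.1 hw).2.symm))
    (fun v hv => h2 v (Finset.mem_filter.1 hv).1)
  have b1 := indep_bound G (T.filter (fun v => ¬ c v = 0))
    (by
      intro v hv w hw hadj
      have h3 := (Finset.mem_filter.1 hv).2
      have h4 := (Finset.mem_filter.1 hw).2
      have h5 := c.valid hadj
      omega)
    (fun v hv => h2 v (Finset.mem_filter.1 hv).1)
  rw [Real.sqrt_le_left (by positivity), ← Finset.prod_filter_mul_prod_filter_not T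
    (fun v => c v = 0), sq]
  refine mul_le_mul b0 b1 ?_ (by positivity)
  apply Finset.prod_nonneg
  intro v hv
  have : (2 : ℝ) ≤ G.degree v := by exact_mod_cast h2 v (Finset.mem_filter.1 hv).1
  linarith
end
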